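/- Let a(z) = (1+z)/2, b₀(z) = z(1−z)/2, I(z) = zB(z) with B a Blaschke product with zeros rₙ ∈ (−1,0) converging to −1, b = I·b₀ and f = a/(1−b). Then for every n, the function f·k_{rₙ}·I − b₀(rₙ)·f·k_{rₙ} is orthogonal in H² to the subspace fK_I, where k_λ(z) = (1 − λ̄z)^{−1}. -/

import Mathlib

open Complex MeasureTheory Filter Set

noncomputable section

/-! ### Basic framework: Hardy spaces on the unit disk via boundary values -/

/-- The open unit disk in the complex plane. -/
def unitDisk : Set ℂ := Metric.ball 0 1

/-- The point `e^{iθ}` of the unit circle. -/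
def uc (θ : ℝ) : ℂ := Complex.exp ((θ : ℂ) * Complex.I)

/-- Lebesgue measure on the parameter interval `(0, 2π]` of the unit circle. -/
def bMeasure : Measure ℝ := volume.restrict (Set.Ioc 0 (2 * Real.pi))

/-- Radial limit of `f` at the boundary point `w` (`|w| = 1`). -/
def radLim (f : ℂ → ℂ) (w : ℂ) : ℂ :=
  limUnder (nhdsWithin (1 : ℝ) (Set.Iio 1)) fun r : ℝ => f ((r : ℂ) * w)

/-- The boundary value function of `f` on the unit circle. -/
def bdry (f : ℂ → ℂ) (θ : ℝ) : ℂ := radLim f (uc θ)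

/-- Membership in the Hardy space `H²` of the unit disk. -/
def MemH2 (f : ℂ → ℂ) : Prop :=
  DifferentiableOn ℂ f unitDisk ∧
    ∃ C : ℝ, ∀ r ∈ Set.Ico (0 : ℝ) 1,
      (∫ θ in (0:ℝ)..(2 * Real.pi), ‖f ((r : ℂ) * uc θ)‖ ^ 2) ≤ C

/-- Membership in the Hardy space `H¹` of the unit disk. -/
def MemH1 (f : ℂ → ℂ) : Prop :=
  DifferentiableOn ℂ f unitDisk ∧
    ∃ C : ℝ, ∀ r ∈ Set.Ico (0 : ℝ) 1,
      (∫ θ in (0:ℝ)..(2 * Real.pi), ‖f ((r : ℂ) * uc θ)‖) ≤ C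

/-- Membership in `H^∞` (bounded holomorphic functions on the disk). -/
def MemHinf (f : ℂ → ℂ) : Prop :=
  DifferentiableOn ℂ f unitDisk ∧ ∃ C : ℝ, ∀ z ∈ unitDisk, ‖f z‖ ≤ C

/-- The `H²` (normalized boundary `L²`) inner product `⟨f, g⟩`. -/
def bInner (f g : ℂ → ℂ) : ℂ :=
  (1 / (2 * (Real.pi : ℂ))) *
    ∫ θ in (0:ℝ)..(2 * Real.pi), bdry f θ * (starRingEnd ℂ) (bdry g θ)

/-- The squared `H²` norm, computed on the boundary. -/
def bNormSq (f : ℂ → ℂ) : ℝ :=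
  (1 / (2 * Real.pi)) * ∫ θ in (0:ℝ)..(2 * Real.pi), ‖bdry f θ‖ ^ 2

/-- `f` is an inner function. -/
def IsInner (f : ℂ → ℂ) : Prop :=
  DifferentiableOn ℂ f unitDisk ∧ (∀ z ∈ unitDisk, ‖f z‖ ≤ 1) ∧
    ∀ᵐ θ ∂bMeasure, ‖bdry f θ‖ = 1

/-- `f` is an outer function: it is, up to a unimodular constant, the Herglotz
exponential of the Poisson integral of `log |f*|`. -/
def IsOuter (f : ℂ → ℂ) : Prop :=
  DifferentiableOn ℂ f unitDisk ∧ ∃ c : ℂ, ‖c‖ = 1 ∧ ∀ z ∈ unitDisk,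
    f z = c * Complex.exp ((1 / (2 * (Real.pi : ℂ))) *
      ∫ θ in (0:ℝ)..(2 * Real.pi),
        ((uc θ + z) / (uc θ - z)) * ((Real.log ‖bdry f θ‖ : ℝ) : ℂ))

/-- `b` is a nonextreme point of the closed unit ball of `H^∞`:
`log (1 - |b|)` is integrable on the circle. -/
def Nonextreme (b : ℂ → ℂ) : Prop :=
  DifferentiableOn ℂ b unitDisk ∧ (∀ z ∈ unitDisk, ‖b z‖ ≤ 1) ∧
    Integrable (fun θ => Real.log (1 - ‖bdry b θ‖)) bMeasure

/-- `(b, a)` is a pair: `b` nonextreme, `a` outer, `|a|² + |b|² = 1` a.e. on the circle. -/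
def IsPair (b a : ℂ → ℂ) : Prop :=
  Nonextreme b ∧ IsOuter a ∧
    ∀ᵐ θ ∂bMeasure, ‖bdry a θ‖ ^ 2 + ‖bdry b θ‖ ^ 2 = 1

/-- `(b, a)` is the pair associated with the outer function `f` of unit `H²` norm:
`f = a / (1 - b)`. -/
def PairAssoc (f b a : ℂ → ℂ) : Prop :=
  IsOuter f ∧ MemH2 f ∧ bNormSq f = 1 ∧ IsPair b a ∧
    ∀ z ∈ unitDisk, f z = a z / (1 - b z)

/-- The Herglotz measure `μ_λ` of `(1 + λ̄b)/(1 − λ̄b)` is absolutely continuous: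
the Herglotz representation holds with density `|a/(1 − λ̄b)|²` and no singular part. -/
def HerglotzAC (b a : ℂ → ℂ) (lam : ℂ) : Prop :=
  ∀ z ∈ unitDisk,
    (1 + (starRingEnd ℂ) lam * b z) / (1 - (starRingEnd ℂ) lam * b z) =
      (1 / (2 * (Real.pi : ℂ))) *
        (∫ θ in (0:ℝ)..(2 * Real.pi),
          ((1 + (uc θ)⁻¹ * z) / (1 - (uc θ)⁻¹ * z)) *
            ((‖bdry (fun w => a w / (1 - (starRingEnd ℂ) lam * b w)) θ‖ ^ 2 : ℝ) : ℂ)) +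
      Complex.I *
        ((((1 + (starRingEnd ℂ) lam * b 0) / (1 - (starRingEnd ℂ) lam * b 0)).im : ℝ) : ℂ)

/-- The pair `(b, a)` is special: the Herglotz measure of `(1+b)/(1−b)` is
absolutely continuous. -/
def SpecialPair (b a : ℂ → ℂ) : Prop := IsPair b a ∧ HerglotzAC b a 1

/-- `F ∈ H¹` is rigid: the only functions of `H¹` with the same argument a.e. on the
circle are the positive scalar multiples of `F`. -/
def Rigid (F : ℂ → ℂ) : Prop :=
  MemH1 F ∧ ∀ G : ℂ → ℂ, MemH1 G →
    (∀ᵐ θ ∂bMeasure, ∃ t : ℝ, 0 < t ∧ bdry G θ = (t : ℂ) * bdry F θ) →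
    ∃ c : ℝ, 0 < c ∧ ∀ z ∈ unitDisk, G z = (c : ℂ) * F z

/-- The Riesz (analytic) projection `P₊` of a boundary function, realized through the
Szegő integral: `(P₊u)(z) = (1/2π) ∫ u(θ) (1 − z e^{-iθ})⁻¹ dθ`. -/
def szProj (u : ℝ → ℂ) : ℂ → ℂ := fun z =>
  (1 / (2 * (Real.pi : ℂ))) *
    ∫ θ in (0:ℝ)..(2 * Real.pi), u θ * (1 - z * (uc θ)⁻¹)⁻¹

/-- The Toeplitz operator with boundary symbol `φ`: `T_φ h = P₊(φ · h*)`. -/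
def toeplitz (φ : ℝ → ℂ) (h : ℂ → ℂ) : ℂ → ℂ := szProj fun θ => φ θ * bdry h θ

/-- The kernel of the Toeplitz operator `T_φ`, as a subset of `H²`. -/
def toeplitzKer (φ : ℝ → ℂ) : Set (ℂ → ℂ) :=
  {h | MemH2 h ∧ ∀ z ∈ unitDisk, toeplitz φ h z = 0}

/-- The boundary symbol `ḡ` of a function `g` on the disk. -/
def conjBdry (g : ℂ → ℂ) : ℝ → ℂ := fun θ => (starRingEnd ℂ) (bdry g θ)

/-- The boundary symbol `ḡ/g`. -/
def symbQuot (g : ℂ → ℂ) : ℝ → ℂ := fun θ => (starRingEnd ℂ) (bdry g θ) / bdry g θ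

/-- The boundary symbol `Ī f̄ / f`. -/
def symbIf (I f : ℂ → ℂ) : ℝ → ℂ :=
  fun θ => (starRingEnd ℂ) (bdry I θ) * (starRingEnd ℂ) (bdry f θ) / bdry f θ

/-- The model space `K_I = H² ⊖ I H² = ker T_Ī` of an inner function `I`. -/
def modelSpace (I : ℂ → ℂ) : Set (ℂ → ℂ) := toeplitzKer (conjBdry I)

/-- The set `f·K_I`. -/
def fModel (f I : ℂ → ℂ) : Set (ℂ → ℂ) :=
  {g | ∃ h ∈ modelSpace I, ∀ z ∈ unitDisk, g z = f z * h z}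

/-- The orthogonal complement `ker T_{Ī f̄/f} ⊖ f·K_I` of `f·K_I` in the kernel of
`T_{Ī f̄/f}`, with respect to the `H²` inner product. -/
def kerPerp (I f : ℂ → ℂ) : Set (ℂ → ℂ) :=
  {h | h ∈ toeplitzKer (symbIf I f) ∧ ∀ g ∈ fModel f I, bInner h g = 0}

/-- `M(a) = T_a H² = a·H²` (for `a ∈ H^∞`), the range of `T_a`, as a set. -/
def rangeMa (a : ℂ → ℂ) : Set (ℂ → ℂ) :=
  {g | ∃ h, MemH2 h ∧ ∀ z ∈ unitDisk, g z = a z * h z}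

/-- Membership in the de Branges–Rovnyak space `H(b)` for nonextreme `b` with
pair `(b, a)`:  `h ∈ H(b)` iff `h ∈ H²` and `T_b̄ h = T_ā h⁺` for some `h⁺ ∈ H²`
(Sarason's characterization). -/
def MemHb (b a h : ℂ → ℂ) : Prop :=
  MemH2 h ∧ ∃ h' : ℂ → ℂ, MemH2 h' ∧
    ∀ z ∈ unitDisk, toeplitz (conjBdry b) h z = toeplitz (conjBdry a) h' z

/-- The function `h⁺ ∈ H²` with `T_b̄ h = T_ā h⁺` (unique when it exists, since `a`
is outer). -/
def plusFun (b a h : ℂ → ℂ) : ℂ → ℂ :=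
  Classical.epsilon fun h' : ℂ → ℂ => MemH2 h' ∧
    ∀ z ∈ unitDisk, toeplitz (conjBdry b) h z = toeplitz (conjBdry a) h' z

/-- The inner product of `H(b)`: `⟨h, g⟩_b = ⟨h, g⟩₂ + ⟨h⁺, g⁺⟩₂`. -/
def hbInner (b a h g : ℂ → ℂ) : ℂ :=
  bInner h g + bInner (plusFun b a h) (plusFun b a g)

/-- The squared norm of `H(b)`. -/
def hbNormSq (b a h : ℂ → ℂ) : ℝ := (hbInner b a h h).re

/-- The closure of a set `S` in the norm of `H(b)`. -/
def hbClosure (b a : ℂ → ℂ) (S : Set (ℂ → ℂ)) : Set (ℂ → ℂ) :=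
  {h | MemHb b a h ∧ ∀ ε : ℝ, 0 < ε → ∃ g ∈ S,
    hbNormSq b a (fun z => h z - g z) < ε}

/-- The orthogonal complement of `S` in `H(b)`. -/
def hbPerp (b a : ℂ → ℂ) (S : Set (ℂ → ℂ)) : Set (ℂ → ℂ) :=
  {h | MemHb b a h ∧ ∀ g ∈ S, hbInner b a h g = 0}

/-- A set of functions on the disk is a `k`-dimensional linear subspace. -/
def HasDimOn (S : Set (ℂ → ℂ)) (k : ℕ) : Prop :=
  ∃ g : Fin k → (ℂ → ℂ), (∀ j, g j ∈ S) ∧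
    (∀ c : Fin k → ℂ, (∀ z ∈ unitDisk, (∑ j, c j * g j z) = 0) → c = 0) ∧
    ∀ h ∈ S, ∃ c : Fin k → ℂ, ∀ z ∈ unitDisk, h z = ∑ j, c j * g j z

/-- The Szegő kernel `k_w(z) = (1 - w̄ z)⁻¹` of `H²`. -/
def szKernel (w z : ℂ) : ℂ := (1 - (starRingEnd ℂ) w * z)⁻¹

/-- The reproducing kernel of `H(b)` at an interior point `w ∈ 𝔻`. -/
def hbKernel (b : ℂ → ℂ) (w z : ℂ) : ℂ :=
  (1 - (starRingEnd ℂ) (b w) * b z) / (1 - (starRingEnd ℂ) w * z)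

/-- The boundary kernel of `H(b)` at a boundary point `z₀`, defined through the
nontangential limit `b(z₀) = radLim b z₀`. -/
def hbBoundaryKernel (b : ℂ → ℂ) (z₀ z : ℂ) : ℂ :=
  (1 - (starRingEnd ℂ) (radLim b z₀) * b z) / (1 - (starRingEnd ℂ) z₀ * z)

/-- `u` is a nontangential approach sequence to the boundary point `z₀`. -/
def NTApproach (u : ℕ → ℂ) (z₀ : ℂ) : Prop :=
  (∀ n, u n ∈ unitDisk) ∧ Filter.Tendsto u Filter.atTop (nhds z₀) ∧
    ∃ M : ℝ, ∀ n, ‖u n - z₀‖ ≤ M * (1 - ‖u n‖)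

/-- `b` has an angular derivative in the sense of Carathéodory at `z₀ ∈ ∂𝔻`. -/
def HasADC (b : ℂ → ℂ) (z₀ : ℂ) : Prop :=
  ‖radLim b z₀‖ = 1 ∧ ∃ L : ℂ, ∀ u : ℕ → ℂ, NTApproach u z₀ →
    Filter.Tendsto (fun n => b (u n)) Filter.atTop (nhds (radLim b z₀)) ∧
    Filter.Tendsto (fun n => (b (u n) - radLim b z₀) / (u n - z₀)) Filter.atTop (nhds L)

theorem uc_norm (θ : ℝ) : ‖uc θ‖ = 1 := by
  simp [uc, Complex.norm_exp_ofReal_mul_I]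

theorem uc_ne_zero (θ : ℝ) : uc θ ≠ 0 := Complex.exp_ne_zero _

theorem continuous_uc : Continuous uc := by
  unfold uc; fun_prop

theorem uc_add (s t : ℝ) : uc (s + t) = uc s * uc t := by
  simp [uc, add_mul, Complex.exp_add]

theorem uc_inv (θ : ℝ) : (uc θ)⁻¹ = (starRingEnd ℂ) (uc θ) := by
  rw [Complex.inv_def, Complex.normSq_eq_norm_sq, uc_norm]; simp

theorem uc_eq_cos_sin (θ : ℝ) : uc θ = (Real.cos θ : ℂ) + (Real.sin θ : ℂ) * Complex.I := by
  rw [uc, Complex.exp_mul_I]; simp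

theorem uc_inv_eq_cos_sin (θ : ℝ) :
    (uc θ)⁻¹ = (Real.cos θ : ℂ) - (Real.sin θ : ℂ) * Complex.I := by
  rw [uc_inv, uc_eq_cos_sin, map_add, map_mul, Complex.conj_ofReal, Complex.conj_ofReal,
    Complex.conj_I]
  ring

theorem integral_uc_zpow (a : ℝ) (k : ℤ) (hk : k ≠ 0) :
    ∫ θ in a..(a + 2 * Real.pi), (uc θ) ^ k = 0 := by
  have hc : (k : ℂ) * Complex.I ≠ 0 := mul_ne_zero (by exact_mod_cast hk) Complex.I_ne_zero
  have h1 : ∀ θ : ℝ, (uc θ) ^ k = Complex.exp ((k : ℂ) * Complex.I * θ) := fun θ => by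
    rw [uc, ← Complex.exp_int_mul]; ring_nf
  simp_rw [h1]
  rw [integral_exp_mul_complex hc]
  have : Complex.exp ((k : ℂ) * Complex.I * ((a + 2 * Real.pi : ℝ) : ℂ))
      = Complex.exp ((k : ℂ) * Complex.I * (a : ℂ)) := by
    rw [Complex.exp_eq_exp_iff_exists_int]
    exact ⟨k, by push_cast; ring⟩
  rw [this, sub_self, zero_div]

theorem integral_uc_pow_mul_inv_pow (a : ℝ) (n m : ℕ) :
    ∫ θ in a..(a + 2 * Real.pi), (uc θ) ^ n * ((uc θ)⁻¹) ^ m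
      = if n = m then (2 * Real.pi : ℂ) else 0 := by
  have h : ∀ θ : ℝ, (uc θ) ^ n * ((uc θ)⁻¹) ^ m = (uc θ) ^ ((n : ℤ) - m) := fun θ => by
    rw [zpow_sub₀ (uc_ne_zero θ)]; simp [div_eq_mul_inv]
  simp_rw [h]
  split_ifs with hnm
  · simp [hnm]
  · exact integral_uc_zpow a _ (by omega)

theorem integral_uc_pow (a : ℝ) (n : ℕ) (hn : n ≠ 0) :
    ∫ θ in a..(a + 2 * Real.pi), (uc θ) ^ n = 0 := by
  simpa using integral_uc_zpow a n (by exact_mod_cast hn)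

/-- Termwise integration of an absolutely convergent series of bounded functions against an
integrable function. -/
theorem hasSum_integral_mul_series {a b : ℝ} {g : ℝ → ℂ} (hg : IntervalIntegrable g volume a b)
    {u : ℕ → ℝ → ℂ} (hu : ∀ n, Continuous (u n)) (hu1 : ∀ n t, ‖u n t‖ ≤ 1)
    {d : ℕ → ℂ} (hd : Summable fun n => ‖d n‖) :
    HasSum (fun n => d n * ∫ t in a..b, g t * u n t) (∫ t in a..b, g t * ∑' n, d n * u n t) := by
  have hsum : ∀ t, Summable fun n => d n * u n t := fun t =>
    Summable.of_norm_bounded hd fun n => by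
      rw [norm_mul]; exact mul_le_of_le_one_right (norm_nonneg _) (hu1 n t)
  have key := intervalIntegral.hasSum_integral_of_dominated_convergence (μ := volume) (a := a)
    (b := b) (F := fun n t => g t * (d n * u n t)) (f := fun t => g t * ∑' n, d n * u n t)
    (fun n t => ‖g t‖ * ‖d n‖)
    (fun n => hg.aestronglyMeasurable_restrict_uIoc.mul
      ((hu n).const_smul (d n)).aestronglyMeasurable)
    (fun n => ae_of_all _ fun t _ => by
      rw [norm_mul, norm_mul]
      exact mul_le_mul_of_nonneg_left
        (mul_le_of_le_one_right (norm_nonneg _) (hu1 n t)) (norm_nonneg _))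
    (ae_of_all _ fun t _ => hd.mul_left _)
    (by
      simp_rw [tsum_mul_left]
      exact hg.norm.mul_const _)
    (ae_of_all _ fun t _ => (hsum t).hasSum.mul_left _)
  have e : (fun n => d n * ∫ t in a..b, g t * u n t)
      = fun n => ∫ t in a..b, g t * (d n * u n t) := funext fun n => by
    rw [← intervalIntegral.integral_const_mul]
    exact intervalIntegral.integral_congr fun t _ => by ring
  rw [e]
  exact key

/-- The negative of the angular derivative of the Poisson kernel. -/
def dPoisson (ρ t : ℝ) : ℝ :=
  2 * ρ * (1 - ρ ^ 2) * Real.sin t / (1 - 2 * ρ * Real.cos t + ρ ^ 2) ^ 2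

theorem poisson_denom_pos {ρ : ℝ} (hρ : ρ ∈ Set.Ico (0 : ℝ) 1) (t : ℝ) :
    0 < 1 - 2 * ρ * Real.cos t + ρ ^ 2 := by
  nlinarith [Real.cos_le_one t, hρ.1, hρ.2, mul_nonneg hρ.1 (sub_nonneg.2 (Real.cos_le_one t)),
    sq_pos_of_pos (sub_pos.2 hρ.2)]

theorem continuous_dPoisson {ρ : ℝ} (hρ : ρ ∈ Set.Ico (0 : ℝ) 1) : Continuous (dPoisson ρ) := by
  unfold dPoisson
  refine Continuous.div (by fun_prop) (by fun_prop) fun t => ?_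
  exact pow_ne_zero _ (poisson_denom_pos hρ t).ne'

theorem norm_ofReal_mul_uc {ρ : ℝ} (hρ : 0 ≤ ρ) (t : ℝ) : ‖(ρ : ℂ) * uc t‖ = ρ := by
  rw [norm_mul, uc_norm, mul_one, Complex.norm_real, Real.norm_of_nonneg hρ]

theorem dPoisson_eq_koebe {ρ : ℝ} (hρ : ρ ∈ Set.Ico (0 : ℝ) 1) (t : ℝ) :
    (dPoisson ρ t : ℂ) = -Complex.I * ((ρ * uc t) / (1 - ρ * uc t) ^ 2
      - (ρ * (uc t)⁻¹) / (1 - ρ * (uc t)⁻¹) ^ 2) := by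
  have h1 : (1 - (ρ : ℂ) * uc t) ≠ 0 := fun h => by
    have := norm_ofReal_mul_uc hρ.1 t
    rw [← sub_eq_zero.1 h] at this
    simp at this; linarith [hρ.2]
  have h2 : (1 - (ρ : ℂ) * (uc t)⁻¹) ≠ 0 := fun h => h1 <| by
    rw [uc_inv] at h
    simpa using congrArg (starRingEnd ℂ) h
  have hcs : uc t * (uc t)⁻¹ = 1 := mul_inv_cancel₀ (uc_ne_zero t)
  have hs : (Real.sin t : ℂ) = -Complex.I * (uc t - (uc t)⁻¹) / 2 := by
    rw [uc_inv_eq_cos_sin, uc_eq_cos_sin]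
    linear_combination (Real.sin t : ℂ) * Complex.I_sq
  have hd : ((1 - 2 * ρ * Real.cos t + ρ ^ 2 : ℝ) : ℂ)
      = (1 - (ρ : ℂ) * uc t) * (1 - (ρ : ℂ) * (uc t)⁻¹) := by
    have : (2 * Real.cos t : ℂ) = uc t + (uc t)⁻¹ := by
      rw [uc_inv_eq_cos_sin, uc_eq_cos_sin]; ring
    push_cast at this ⊢
    linear_combination (-(ρ : ℂ)) * this - ρ ^ 2 * hcs
  rw [dPoisson, Complex.ofReal_div, Complex.ofReal_pow, hd]
  push_cast
  push_cast at hs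
  rw [hs]
  generalize uc t = w at *
  generalize w⁻¹ = v at *
  field_simp
  linear_combination (-ρ ^ 3 * (w - v)) * hcs

theorem integral_uc_pow_mul_dPoisson {ρ : ℝ} (hρ : ρ ∈ Set.Ico (0 : ℝ) 1) (n : ℕ) :
    ∫ t in (-Real.pi)..Real.pi, (dPoisson ρ t : ℂ) * uc t ^ n
      = 2 * Real.pi * Complex.I * (n * ρ ^ n) := by
  have hpi : (Real.pi : ℝ) = -Real.pi + 2 * Real.pi := by ring
  have hd : Summable fun m : ℕ => ‖(m : ℂ) * (ρ : ℂ) ^ m‖ := by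
    have := (hasSum_coe_mul_geometric_of_norm_lt_one (𝕜 := ℂ) (r := (ρ : ℂ))
      (by rw [Complex.norm_real, Real.norm_of_nonneg hρ.1]; exact hρ.2)).summable
    exact this.norm
  have hg : IntervalIntegrable (fun t => uc t ^ n) volume (-Real.pi) Real.pi :=
    (continuous_uc.pow n).intervalIntegrable _ _
  have hK : ∀ v : ℂ, ‖v‖ = 1 → ∑' m : ℕ, (m : ℂ) * (ρ : ℂ) ^ m * v ^ m
      = (ρ * v) / (1 - ρ * v) ^ 2 := fun v hv => by
    rw [← tsum_coe_mul_geometric_of_norm_lt_one]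
    · simp_rw [mul_pow, mul_assoc]
    · rw [norm_mul, hv, mul_one, Complex.norm_real, Real.norm_of_nonneg hρ.1]; exact hρ.2
  have A := hasSum_integral_mul_series hg (u := fun m t => uc t ^ m)
    (fun m => continuous_uc.pow m) (fun m t => by simp [uc_norm]) hd
  have B := hasSum_integral_mul_series hg (u := fun m t => (uc t)⁻¹ ^ m)
    (fun m => (continuous_uc.inv₀ uc_ne_zero).pow m) (fun m t => by simp [uc_norm]) hd
  have A0 : ∫ t in (-Real.pi)..Real.pi, uc t ^ n * ∑' m : ℕ, (m : ℂ) * (ρ : ℂ) ^ m * uc t ^ m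
      = 0 := by
    refine A.unique ?_
    convert hasSum_zero with m
    rcases Nat.eq_zero_or_pos m with rfl | hm
    · simp
    · simp_rw [← pow_add]
      have := integral_uc_pow (-Real.pi) (n + m) (by omega)
      rw [← hpi] at this
      rw [this, mul_zero]
  have B0 : ∫ t in (-Real.pi)..Real.pi, uc t ^ n * ∑' m : ℕ, (m : ℂ) * (ρ : ℂ) ^ m * (uc t)⁻¹ ^ m
      = 2 * Real.pi * (n * ρ ^ n) := by
    refine B.unique ?_
    have : ∀ m : ℕ, ∫ t in (-Real.pi)..Real.pi, uc t ^ n * (uc t)⁻¹ ^ m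
      = if n = m then (2 * Real.pi : ℂ) else 0 := fun m => by
        have := integral_uc_pow_mul_inv_pow (-Real.pi) n m
        rwa [← hpi] at this
    simp_rw [this]
    convert hasSum_ite_eq n ((2 * Real.pi * (n * ρ ^ n) : ℂ)) using 2 with m
    by_cases h : n = m
    · subst h; simp; ring
    · simp [h, Ne.symm h]
  have e : ∀ t, (dPoisson ρ t : ℂ) * uc t ^ n = -Complex.I * (
      uc t ^ n * ∑' m : ℕ, (m : ℂ) * (ρ : ℂ) ^ m * uc t ^ m
      - uc t ^ n * ∑' m : ℕ, (m : ℂ) * (ρ : ℂ) ^ m * (uc t)⁻¹ ^ m) := fun t => by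
    rw [hK _ (uc_norm t), hK _ (by rw [norm_inv, uc_norm, inv_one]), dPoisson_eq_koebe hρ]
    ring
  have hcont : ∀ v : ℝ → ℂ, Continuous v → (∀ t, ‖v t‖ = 1) →
      IntervalIntegrable (fun t => uc t ^ n * ∑' m : ℕ, (m : ℂ) * (ρ : ℂ) ^ m * v t ^ m) volume
        (-Real.pi) Real.pi := fun v hv hv1 => by
    refine Continuous.intervalIntegrable ?_ _ _
    refine (continuous_uc.pow n).mul (continuous_tsum (fun m => by fun_prop) hd fun m t => ?_)
    simp [hv1]
  simp_rw [e]
  rw [intervalIntegral.integral_const_mul, intervalIntegral.integral_sub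
    (hcont _ continuous_uc uc_norm)
    (hcont (fun t => (uc t)⁻¹) (continuous_uc.inv₀ uc_ne_zero) (fun t => by rw [norm_inv, uc_norm, inv_one])),
    A0, B0]
  ring

theorem integral_dPoisson {ρ : ℝ} (hρ : ρ ∈ Set.Ico (0 : ℝ) 1) :
    ∫ t in (-Real.pi)..Real.pi, dPoisson ρ t = 0 := by
  have := integral_uc_pow_mul_dPoisson hρ 0
  simp only [pow_zero, mul_one, Nat.cast_zero, mul_zero] at this
  rw [intervalIntegral.integral_ofReal] at this
  exact_mod_cast this

theorem integral_sin_mul_dPoisson {ρ : ℝ} (hρ : ρ ∈ Set.Ico (0 : ℝ) 1) :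
    ∫ t in (-Real.pi)..Real.pi, dPoisson ρ t * Real.sin t = 2 * Real.pi * ρ := by
  have h := integral_uc_pow_mul_dPoisson hρ 1
  have hi : ∀ t : ℝ, (dPoisson ρ t : ℂ) * uc t ^ 1
      = ((dPoisson ρ t * Real.cos t : ℝ) : ℂ)
        + Complex.I * ((dPoisson ρ t * Real.sin t : ℝ) : ℂ) := fun t => by
    rw [pow_one, uc_eq_cos_sin]; push_cast; ring
  have hc := continuous_dPoisson hρ
  simp_rw [hi] at h
  rw [intervalIntegral.integral_add
    (Continuous.intervalIntegrable (by fun_prop) _ _)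
    (Continuous.intervalIntegrable (by fun_prop) _ _),
    intervalIntegral.integral_const_mul, intervalIntegral.integral_ofReal,
    intervalIntegral.integral_ofReal] at h
  have := congrArg Complex.im h
  simpa using this

theorem dPoisson_mul_sin_nonneg {ρ : ℝ} (hρ : ρ ∈ Set.Ico (0 : ℝ) 1) (t : ℝ) :
    0 ≤ dPoisson ρ t * Real.sin t := by
  have : dPoisson ρ t * Real.sin t
      = 2 * ρ * (1 - ρ ^ 2) * Real.sin t ^ 2 / (1 - 2 * ρ * Real.cos t + ρ ^ 2) ^ 2 := by
    unfold dPoisson; ring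
  rw [this]
  have h1 : 0 ≤ 1 - ρ ^ 2 := by nlinarith [hρ.1, hρ.2]
  have := hρ.1
  positivity

theorem abs_dPoisson_mul_le {ρ : ℝ} (hρ : ρ ∈ Set.Ico (0 : ℝ) 1) {t : ℝ}
    (ht : |t| ≤ Real.pi / 2) :
    |dPoisson ρ t| * |t| ≤ Real.pi / 2 * (dPoisson ρ t * Real.sin t) := by
  have h1 : |t| ≤ Real.pi / 2 * |Real.sin t| := by
    have := Real.mul_abs_le_abs_sin ht
    have hpi := Real.pi_pos
    calc |t| = Real.pi / 2 * (2 / Real.pi * |t|) := by field_simp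
      _ ≤ _ := by gcongr
  rw [← abs_of_nonneg (dPoisson_mul_sin_nonneg hρ t), abs_mul]
  nlinarith [abs_nonneg (dPoisson ρ t)]

theorem abs_dPoisson_le {ρ δ t : ℝ} (hρ : ρ ∈ Set.Ico (1 / 2 : ℝ) 1) (hδ : 0 < δ)
    (hδt : δ ≤ |t|) (ht : |t| ≤ Real.pi) :
    |dPoisson ρ t| ≤ 2 * (1 - ρ ^ 2) / (1 - Real.cos δ) ^ 2 := by
  have hcos : Real.cos t ≤ Real.cos δ := by
    rw [← Real.cos_abs t]; exact Real.cos_le_cos_of_nonneg_of_le_pi hδ.le ht hδt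
  have hδ1 : 0 < 1 - Real.cos δ := by
    have : Real.cos δ < Real.cos 0 :=
      Real.cos_lt_cos_of_nonneg_of_le_pi le_rfl (hδt.trans ht) hδ
    simp at this; linarith
  have h1 : 0 ≤ 1 - ρ ^ 2 := by nlinarith [hρ.1, hρ.2]
  have h0 : 0 ≤ ρ := by linarith [hρ.1]
  have hden : 1 - Real.cos δ ≤ 1 - 2 * ρ * Real.cos t + ρ ^ 2 := by
    nlinarith [hρ.1, hρ.2, sq_nonneg (1 - ρ), Real.cos_le_one t]
  unfold dPoisson
  rw [abs_div, abs_mul, abs_of_nonneg (show 0 ≤ 2 * ρ * (1 - ρ ^ 2) by positivity),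
    abs_sq]
  apply div_le_div₀ (by positivity) _ (by positivity) (by gcongr)
  calc 2 * ρ * (1 - ρ ^ 2) * |Real.sin t| ≤ 2 * 1 * (1 - ρ ^ 2) * 1 := by
        gcongr
        · exact hρ.2.le
        · exact Real.abs_sin_le_one t
    _ = _ := by ring

/-- The differentiated Poisson kernel annihilates, in the limit, every continuous function
that is `o(t)` at the origin. -/
theorem tendsto_integral_dPoisson_mul {R : ℝ → ℂ} (hR : Continuous R)
    (hR0 : R =o[nhds 0] fun t : ℝ => t) :
    Tendsto (fun ρ : ℝ => ∫ t in (-Real.pi)..Real.pi, (dPoisson ρ t : ℂ) * R t)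
      (nhdsWithin 1 (Set.Iio 1)) (nhds 0) := by
  have hpi := Real.pi_pos
  obtain ⟨M, hM⟩ := (isCompact_Icc (a := -Real.pi) (b := Real.pi)).exists_bound_of_continuousOn
    hR.continuousOn
  have hM0 : 0 ≤ M := (norm_nonneg _).trans (hM 0 ⟨by linarith, by linarith⟩)
  rw [Metric.tendsto_nhds]
  intro ε hε
  set η : ℝ := ε / (2 * Real.pi ^ 2) with hη
  have hη0 : 0 < η := by positivity
  obtain ⟨δ₀, hδ₀, hball⟩ := Metric.eventually_nhds_iff.1 (hR0.def hη0)
  set δ := min (δ₀ / 2) (Real.pi / 2) with hδdef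
  have hδ : 0 < δ := by positivity
  have hδ2 : δ ≤ Real.pi / 2 := min_le_right _ _
  have hδ3 : δ < δ₀ := (min_le_left _ _).trans_lt (by linarith)
  set κ := 1 - Real.cos δ with hκ
  have hlim : Tendsto (fun ρ : ℝ => 2 * Real.pi * (M * (2 * (1 - ρ ^ 2) / κ ^ 2)))
      (nhdsWithin 1 (Set.Iio 1)) (nhds 0) := by
    have : Continuous fun ρ : ℝ => 2 * Real.pi * (M * (2 * (1 - ρ ^ 2) / κ ^ 2)) := by fun_prop
    have h := this.tendsto 1
    simp only [one_pow, sub_self, mul_zero, zero_div] at h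
    exact h.mono_left nhdsWithin_le_nhds
  have hIoo : Set.Ioo (1 / 2 : ℝ) 1 ∈ nhdsWithin (1 : ℝ) (Set.Iio 1) :=
    Ioo_mem_nhdsLT (by norm_num)
  filter_upwards [hlim.eventually_lt_const hε, hIoo,
    hlim.eventually_lt_const (half_pos hε)] with ρ _ hρ hρε
  have hρ' : ρ ∈ Set.Ico (0 : ℝ) 1 := ⟨by linarith [hρ.1], hρ.2⟩
  have h1 : 0 ≤ 1 - ρ ^ 2 := by nlinarith [hρ.1, hρ.2]
  rw [dist_zero_right]
  have hQ := continuous_dPoisson hρ'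
  have hbound : ∀ t ∈ Set.Ioc (-Real.pi) Real.pi, ‖(dPoisson ρ t : ℂ) * R t‖
      ≤ η * (Real.pi / 2) * (dPoisson ρ t * Real.sin t) + M * (2 * (1 - ρ ^ 2) / κ ^ 2) := by
    intro t ht
    have htpi : |t| ≤ Real.pi := abs_le.2 ⟨ht.1.le, ht.2⟩
    rw [norm_mul, Complex.norm_real, Real.norm_eq_abs]
    have hs := dPoisson_mul_sin_nonneg hρ' t
    rcases lt_or_ge |t| δ with h | h
    · have hRt : ‖R t‖ ≤ η * |t| := hball (by simpa using h.trans hδ3)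
      have := abs_dPoisson_mul_le hρ' (h.le.trans hδ2)
      calc |dPoisson ρ t| * ‖R t‖ ≤ |dPoisson ρ t| * (η * |t|) := by gcongr
        _ = η * (|dPoisson ρ t| * |t|) := by ring
        _ ≤ η * (Real.pi / 2 * (dPoisson ρ t * Real.sin t)) := by gcongr
        _ ≤ _ := by rw [← mul_assoc]; exact le_add_of_nonneg_right (by positivity)
    · have := abs_dPoisson_le ⟨hρ.1.le, hρ.2⟩ hδ h htpi
      calc |dPoisson ρ t| * ‖R t‖ ≤ 2 * (1 - ρ ^ 2) / κ ^ 2 * M := by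
            gcongr
            exact hM t ⟨ht.1.le, ht.2⟩
        _ = M * (2 * (1 - ρ ^ 2) / κ ^ 2) := by ring
        _ ≤ _ := le_add_of_nonneg_left (by positivity)
  have hle := intervalIntegral.norm_integral_le_of_norm_le (μ := volume) (a := -Real.pi)
    (b := Real.pi) (by linarith) (ae_of_all _ hbound)
    (Continuous.intervalIntegrable (by fun_prop) _ _)
  refine hle.trans_lt ?_
  rw [intervalIntegral.integral_add (Continuous.intervalIntegrable (by fun_prop) _ _)
    (Continuous.intervalIntegrable (by fun_prop) _ _), intervalIntegral.integral_const_mul,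
    integral_sin_mul_dPoisson hρ', intervalIntegral.integral_const, smul_eq_mul]
  have e1 : η * (Real.pi / 2) * (2 * Real.pi * ρ) ≤ ε / 2 := by
    have : η * (Real.pi / 2) * (2 * Real.pi * ρ) = ε / 2 * ρ := by
      rw [hη]; field_simp
    rw [this]; nlinarith [hρ.2]
  have e2 : Real.pi - -Real.pi = 2 * Real.pi := by ring
  rw [e2]
  linarith

theorem continuous_fourier_tsum {e : ℕ → ℂ} (he : Summable fun n => ‖e n‖) :
    Continuous fun t : ℝ => ∑' n, e n * uc t ^ n :=
  continuous_tsum (fun n => continuous_const.mul (continuous_uc.pow n)) he fun n t => by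
    simp [uc_norm]

/-- If the boundary function `t ↦ ∑ eₙ e^{int}` is differentiable at `θ`, then
`∑ n eₙ (ρ e^{iθ})ⁿ` converges as `ρ → 1⁻`. -/
theorem exists_radial_limit_of_differentiableAt {e : ℕ → ℂ} (he : Summable fun n => ‖e n‖) {θ : ℝ}
    (hd : DifferentiableAt ℝ (fun t : ℝ => ∑' n, e n * uc t ^ n) θ) :
    ∃ L, Tendsto (fun ρ : ℝ => ∑' n : ℕ, (n : ℂ) * e n * ((ρ : ℂ) * uc θ) ^ n)
      (nhdsWithin 1 (Set.Iio 1)) (nhds L) := by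
  set E : ℝ → ℂ := fun t : ℝ => ∑' n, e n * uc t ^ n with hE
  have hEc : Continuous E := continuous_fourier_tsum he
  set D := deriv E θ with hD
  set R : ℝ → ℂ := fun t => E (θ + t) - E θ - D * Real.sin t with hRdef
  have hRc : Continuous R := by
    have : Continuous fun t : ℝ => ((Real.sin t : ℝ) : ℂ) := by fun_prop
    fun_prop
  have hRo : R =o[nhds 0] fun t : ℝ => t := by
    have h1 : HasDerivAt (fun t : ℝ => E (θ + t)) D 0 := by
      have : HasDerivAt E D (θ + 0) := by rw [add_zero]; exact hd.hasDerivAt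
      exact this.comp_const_add θ 0
    have h2 : HasDerivAt (fun t : ℝ => ((Real.sin t : ℝ) : ℂ)) 1 0 := by
      simpa using (Real.hasDerivAt_sin 0).ofReal_comp
    have h3 : HasDerivAt R 0 0 := by
      have := (h1.sub_const (E θ)).sub (h2.const_mul D)
      rw [mul_one, sub_self] at this
      exact this
    have := h3.isLittleO
    simpa [hRdef] using this
  have hR := tendsto_integral_dPoisson_mul hRc hRo
  have hρt : Tendsto (fun ρ : ℝ => (ρ : ℂ)) (nhdsWithin 1 (Set.Iio 1)) (nhds 1) := by
    have := (Complex.continuous_ofReal.tendsto 1).mono_left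
      (nhdsWithin_le_nhds (s := Set.Iio (1 : ℝ)))
    simpa using this
  have hlim := (hR.add ((hρt.const_mul (D * (2 * Real.pi))))).div_const (2 * Real.pi * Complex.I)
  refine ⟨_, hlim.congr' ?_⟩
  filter_upwards [Ioo_mem_nhdsLT (show (0 : ℝ) < 1 by norm_num)] with ρ hρ
  have hρ' : ρ ∈ Set.Ico (0 : ℝ) 1 := ⟨hρ.1.le, hρ.2⟩
  have hQ := continuous_dPoisson hρ'
  have hQ' : Continuous fun t => (dPoisson ρ t : ℂ) := by fun_prop
  have hI2pi : (2 * Real.pi * Complex.I : ℂ) ≠ 0 := by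
    simp [Real.pi_ne_zero, Complex.I_ne_zero]
  have hser := hasSum_integral_mul_series (a := -Real.pi) (b := Real.pi)
    (hQ'.intervalIntegrable _ _) (u := fun n t => uc t ^ n) (fun n => continuous_uc.pow n)
    (fun n t => by simp [uc_norm]) (d := fun n => e n * uc θ ^ n) (by simpa [uc_norm] using he)
  have h1 : ∫ t in (-Real.pi)..Real.pi, (dPoisson ρ t : ℂ) * E (θ + t)
      = 2 * Real.pi * Complex.I * ∑' n : ℕ, (n : ℂ) * e n * ((ρ : ℂ) * uc θ) ^ n := by
    have h2 : ∀ t, E (θ + t) = ∑' n, e n * uc θ ^ n * uc t ^ n := fun t => by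
      simp only [hE, uc_add, mul_pow, mul_assoc]
    simp_rw [h2]
    rw [← hser.tsum_eq, ← tsum_mul_left]
    refine tsum_congr fun n => ?_
    rw [integral_uc_pow_mul_dPoisson hρ']
    ring
  have h3 : ∫ t in (-Real.pi)..Real.pi, (dPoisson ρ t : ℂ) * R t
      = (∫ t in (-Real.pi)..Real.pi, (dPoisson ρ t : ℂ) * E (θ + t)) - D * (2 * Real.pi * ρ) := by
    have : ∀ t, (dPoisson ρ t : ℂ) * R t = (dPoisson ρ t : ℂ) * E (θ + t)
        - ((dPoisson ρ t : ℂ) * E θ + D * ((dPoisson ρ t * Real.sin t : ℝ) : ℂ)) := fun t => by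
      simp only [hRdef]; push_cast; ring
    simp_rw [this]
    rw [intervalIntegral.integral_sub (Continuous.intervalIntegrable (by fun_prop) _ _)
      (Continuous.intervalIntegrable (by fun_prop) _ _),
      intervalIntegral.integral_add (Continuous.intervalIntegrable (by fun_prop) _ _)
      (Continuous.intervalIntegrable (by fun_prop) _ _), intervalIntegral.integral_mul_const,
      intervalIntegral.integral_const_mul, intervalIntegral.integral_ofReal,
      intervalIntegral.integral_ofReal, integral_dPoisson hρ', integral_sin_mul_dPoisson hρ']
    push_cast; ring
  rw [h3, h1]
  field_simp
  ring

/-- The power series with coefficients `c`. -/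
def diskSum (c : ℕ → ℂ) (z : ℂ) : ℂ := ∑' n, c n * z ^ n

theorem integral_norm_sq_fourier_tsum {d : ℕ → ℂ} (hd : Summable fun n => ‖d n‖) :
    HasSum (fun n => 2 * Real.pi * ‖d n‖ ^ 2)
      (∫ θ in (0:ℝ)..(2 * Real.pi), ‖∑' n, d n * uc θ ^ n‖ ^ 2) := by
  have hc := continuous_fourier_tsum hd
  have hu1 : ∀ (n : ℕ) t, ‖uc t ^ n‖ ≤ 1 := fun n t => by simp [uc_norm]
  have hcoef : ∀ m : ℕ, ∫ θ in (0:ℝ)..(2 * Real.pi),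
      (starRingEnd ℂ) (∑' n, d n * uc θ ^ n) * uc θ ^ m
        = 2 * Real.pi * (starRingEnd ℂ) (d m) := fun m => by
    have h1 := hasSum_integral_mul_series (a := 0) (b := 2 * Real.pi)
      (g := fun t => uc t ^ m) ((continuous_uc.pow m).intervalIntegrable _ _)
      (u := fun n t => ((uc t)⁻¹) ^ n)
      (fun n => (continuous_uc.inv₀ uc_ne_zero).pow n)
      (fun n t => by simp [uc_norm]) (d := fun n => (starRingEnd ℂ) (d n))
      (by simpa using hd)
    have h2 : ∀ n : ℕ, ∫ θ in (0:ℝ)..(2 * Real.pi), uc θ ^ m * ((uc θ)⁻¹) ^ n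
        = if m = n then (2 * Real.pi : ℂ) else 0 := fun n => by
      simpa using integral_uc_pow_mul_inv_pow 0 m n
    simp_rw [h2] at h1
    have h3 := h1.unique (hasSum_single m fun n hn => by simp [Ne.symm hn])
    simp only [if_true] at h3
    rw [mul_comm (2 * (Real.pi : ℂ)), ← h3]
    refine intervalIntegral.integral_congr fun t _ => ?_
    rw [Complex.conj_tsum, mul_comm]
    simp [uc_inv]
  have h := hasSum_integral_mul_series (a := 0) (b := 2 * Real.pi)
    (g := fun θ => (starRingEnd ℂ) (∑' n, d n * uc θ ^ n))
    ((Complex.continuous_conj.comp hc).intervalIntegrable _ _)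
    (u := fun n t => uc t ^ n) (fun n => continuous_uc.pow n) hu1 hd
  simp_rw [hcoef] at h
  have e : ∀ z : ℂ, (starRingEnd ℂ) z * z = ((‖z‖ ^ 2 : ℝ) : ℂ) := fun z => by
    rw [Complex.conj_mul']; norm_cast
  simp_rw [e] at h
  rw [intervalIntegral.integral_ofReal] at h
  rw [← Complex.hasSum_ofReal]
  have e2 : ∀ n, ((2 * Real.pi * ‖d n‖ ^ 2 : ℝ) : ℂ)
      = d n * (2 * Real.pi * (starRingEnd ℂ) (d n)) := fun n => by
    have := Complex.mul_conj' (d n)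
    push_cast
    rw [← this]; ring
  simp_rw [e2]
  exact h

theorem hasSum_coeff {F : ℂ → ℂ} (hF : DifferentiableOn ℂ F unitDisk) {z : ℂ} (hz : z ∈ unitDisk) :
    HasSum (fun n => ((n.factorial : ℂ)⁻¹ * iteratedDeriv n F 0) * z ^ n) (F z) := by
  have := Complex.hasSum_taylorSeries_on_ball hF hz
  simpa [smul_eq_mul, mul_assoc, mul_comm, mul_left_comm] using this

theorem ofReal_mul_uc_mem {ρ : ℝ} (hρ : ρ ∈ Set.Ico (0 : ℝ) 1) (t : ℝ) :
    (ρ : ℂ) * uc t ∈ unitDisk := by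
  rw [unitDisk, mem_ball_zero_iff, norm_ofReal_mul_uc hρ.1]; exact hρ.2

theorem exists_coeff {F : ℂ → ℂ} (hF : DifferentiableOn ℂ F unitDisk) :
    ∃ c : ℕ → ℂ, (∀ ρ ∈ Set.Ico (0:ℝ) 1, Summable fun n => ‖c n * (ρ:ℂ) ^ n‖) ∧
      ∀ z ∈ unitDisk, F z = diskSum c z := by
  refine ⟨_, fun ρ hρ => ?_, fun z hz => (hasSum_coeff hF hz).tsum_eq.symm⟩
  have : (ρ : ℂ) ∈ unitDisk := by simpa [unitDisk, abs_of_nonneg hρ.1] using hρ.2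
  exact (hasSum_coeff hF this).summable.norm

theorem diskSum_ofReal_mul_uc (c : ℕ → ℂ) (ρ θ : ℝ) :
    diskSum c ((ρ : ℂ) * uc θ) = ∑' n, (c n * (ρ : ℂ) ^ n) * uc θ ^ n := by
  simp only [diskSum, mul_pow, mul_assoc]

theorem exists_sq_summable_coeff {h : ℂ → ℂ} (hh : MemH2 h) :
    ∃ c : ℕ → ℂ, (Summable fun n => ‖c n‖ ^ 2) ∧ ∀ z ∈ unitDisk, h z = diskSum c z := by
  obtain ⟨hd, C, hC⟩ := hh
  obtain ⟨c, hc, hs⟩ := exists_coeff hd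
  refine ⟨c, summable_of_sum_range_le (c := C / (2 * Real.pi)) (fun n => sq_nonneg _) fun N => ?_, hs⟩
  have h1 : ∀ ρ ∈ Set.Ico (0:ℝ) 1,
      ∑ n ∈ Finset.range N, ‖c n‖ ^ 2 * (ρ ^ n) ^ 2 ≤ C / (2 * Real.pi) := fun ρ hρ => by
    have h2 := integral_norm_sq_fourier_tsum (hc ρ hρ)
    have h3 := sum_le_hasSum (Finset.range N) (fun n _ => by positivity) h2
    have h4 := hC ρ hρ
    simp_rw [hs _ (ofReal_mul_uc_mem hρ _), diskSum_ofReal_mul_uc] at h4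
    rw [le_div_iff₀' (by positivity), Finset.mul_sum]
    refine le_trans (le_of_eq (Finset.sum_congr rfl fun n _ => ?_)) (h3.trans h4)
    simp [abs_of_nonneg hρ.1, mul_pow]
  have h5 : Tendsto (fun ρ : ℝ => ∑ n ∈ Finset.range N, ‖c n‖ ^ 2 * (ρ ^ n) ^ 2)
      (nhdsWithin 1 (Set.Iio 1)) (nhds (∑ n ∈ Finset.range N, ‖c n‖ ^ 2)) := by
    have : Continuous fun ρ : ℝ => ∑ n ∈ Finset.range N, ‖c n‖ ^ 2 * (ρ ^ n) ^ 2 := by fun_prop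
    simpa using (this.tendsto 1).mono_left (nhdsWithin_le_nhds (s := Set.Iio (1:ℝ)))
  refine le_of_tendsto h5 ?_
  filter_upwards [Ioo_mem_nhdsLT (show (0 : ℝ) < 1 by norm_num)] with ρ hρ
  exact h1 ρ ⟨hρ.1.le, hρ.2⟩

theorem summable_coeff_mul_pow {c : ℕ → ℂ} (hc : Summable fun n => ‖c n‖ ^ 2) {ρ : ℝ}
    (hρ : ρ ∈ Set.Ico (0:ℝ) 1) : Summable fun n => ‖c n * (ρ:ℂ) ^ n‖ := by
  have hg : Summable fun n : ℕ => (ρ ^ 2) ^ n :=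
    summable_geometric_of_lt_one (sq_nonneg _) (by nlinarith [hρ.1, hρ.2])
  refine Summable.of_nonneg_of_le (fun n => norm_nonneg _) (fun n => ?_) (hc.add hg)
  rw [norm_mul, norm_pow, Complex.norm_real, Real.norm_of_nonneg hρ.1, ← pow_mul, mul_comm 2, pow_mul]
  nlinarith [sq_nonneg (‖c n‖ - ρ ^ n), sq_nonneg (‖c n‖), sq_nonneg (ρ ^ n)]

theorem summable_norm_div_nat {c : ℕ → ℂ} (hc : Summable fun n => ‖c n‖ ^ 2) :
    Summable fun n : ℕ => ‖c n / n‖ := by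
  have hg : Summable fun n : ℕ => ((n : ℝ) ^ 2)⁻¹ := Real.summable_nat_pow_inv.2 (by norm_num)
  refine Summable.of_nonneg_of_le (fun n => norm_nonneg _) (fun n => ?_) (hc.add hg)
  rw [norm_div, Complex.norm_natCast, div_eq_mul_inv, ← inv_pow]
  nlinarith [sq_nonneg (‖c n‖ - (n:ℝ)⁻¹), sq_nonneg (‖c n‖), sq_nonneg ((n:ℝ)⁻¹)]

theorem eVariationOn_Icc_le_of_norm_sub_le {F : ℝ → ℂ} {w : ℝ → ℝ} (hw : Continuous w)
    (hw0 : ∀ t, 0 ≤ w t) {a b : ℝ}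
    (hF : ∀ x y, x ≤ y → ‖F y - F x‖ ≤ ∫ t in x..y, w t) :
    eVariationOn F (Set.Icc a b) ≤ ENNReal.ofReal (∫ t in a..b, w t) := by
  refine iSup_le fun ⟨n, u, hu, hus⟩ => ?_
  have hi : ∀ x y, IntervalIntegrable w volume x y := fun x y => hw.intervalIntegrable _ _
  calc ∑ i ∈ Finset.range n, edist (F (u (i + 1))) (F (u i))
      ≤ ∑ i ∈ Finset.range n, ENNReal.ofReal (∫ t in (u i)..(u (i + 1)), w t) := by
        refine Finset.sum_le_sum fun i _ => ?_
        rw [edist_dist, dist_eq_norm]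
        exact ENNReal.ofReal_le_ofReal (hF _ _ (hu (Nat.le_succ i)))
    _ = ENNReal.ofReal (∫ t in (u 0)..(u n), w t) := by
        rw [← intervalIntegral.sum_integral_adjacent_intervals (fun i _ => hi _ _),
          ENNReal.ofReal_sum_of_nonneg]
        exact fun i _ => intervalIntegral.integral_nonneg (hu (Nat.le_succ i)) fun t _ => hw0 t
    _ ≤ _ := by
        refine ENNReal.ofReal_le_ofReal ?_
        exact intervalIntegral.integral_mono_interval (hus 0).1 (hu (Nat.zero_le n)) (hus n).2
          (ae_of_all _ hw0) (hi _ _)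

/-- Cauchy–Schwarz against the constant function. -/
theorem sq_integral_norm_le {F : ℝ → ℂ} (hF : Continuous F) :
    (∫ θ in (0:ℝ)..(2 * Real.pi), ‖F θ‖) ^ 2
      ≤ 2 * Real.pi * ∫ θ in (0:ℝ)..(2 * Real.pi), ‖F θ‖ ^ 2 := by
  set J := ∫ θ in (0:ℝ)..(2 * Real.pi), ‖F θ‖
  have hp : 0 < 2 * Real.pi := by positivity
  have h : 0 ≤ ∫ θ in (0:ℝ)..(2 * Real.pi), (2 * Real.pi * ‖F θ‖ - J) ^ 2 :=
    intervalIntegral.integral_nonneg hp.le fun t _ => sq_nonneg _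
  have e : ∀ θ, (2 * Real.pi * ‖F θ‖ - J) ^ 2
      = (2 * Real.pi) ^ 2 * ‖F θ‖ ^ 2 - 2 * (2 * Real.pi) * J * ‖F θ‖ + J ^ 2 := fun θ => by ring
  simp_rw [e] at h
  rw [intervalIntegral.integral_add (Continuous.intervalIntegrable (by fun_prop) _ _)
      (Continuous.intervalIntegrable (by fun_prop) _ _),
    intervalIntegral.integral_sub (Continuous.intervalIntegrable (by fun_prop) _ _)
      (Continuous.intervalIntegrable (by fun_prop) _ _), intervalIntegral.integral_const_mul,
    intervalIntegral.integral_const_mul, intervalIntegral.integral_const] at h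
  change 0 ≤ _ - 2 * (2 * Real.pi) * J * J + _ at h
  simp only [sub_zero, smul_eq_mul] at h
  nlinarith

theorem hasDerivAt_uc (t : ℝ) : HasDerivAt uc (Complex.I * uc t) t := by
  have h := ((Complex.ofRealCLM.hasDerivAt (x := t)).mul_const Complex.I).cexp
  change HasDerivAt (fun x : ℝ => Complex.exp (x * Complex.I)) _ t
  simpa [uc, mul_comm] using h

theorem integral_I_mul_uc_pow (n : ℕ) (x y : ℝ) :
    (n : ℂ) * ∫ t in x..y, Complex.I * uc t ^ n = uc y ^ n - uc x ^ n := by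
  rw [← intervalIntegral.integral_const_mul]
  refine intervalIntegral.integral_eq_sub_of_hasDerivAt (f := fun t => uc t ^ n) (fun t _ => ?_)
    (Continuous.intervalIntegrable (by have := continuous_uc; fun_prop) _ _)
  rcases n with _ | n
  · simpa using hasDerivAt_const t (1 : ℂ)
  · have h := (hasDerivAt_uc t).fun_pow (n + 1)
    have e : ((n + 1 : ℕ) : ℂ) * uc t ^ (n + 1 - 1) * (Complex.I * uc t)
        = ((n + 1 : ℕ) : ℂ) * (Complex.I * uc t ^ (n + 1)) := by
      rw [Nat.add_sub_cancel]; ring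
    rwa [e] at h

theorem integral_norm_fourier_tsum_le {d : ℕ → ℂ} (hd : Summable fun n => ‖d n‖)
    {v : ℕ → ℝ} (hv : Summable v) (hdv : ∀ n, ‖d n‖ ^ 2 ≤ v n) :
    ∫ θ in (0:ℝ)..(2 * Real.pi), ‖∑' n, d n * uc θ ^ n‖
      ≤ 2 * Real.pi * Real.sqrt (∑' n, v n) := by
  have h1 := integral_norm_sq_fourier_tsum hd
  have h2 := sq_integral_norm_le (continuous_fourier_tsum hd)
  have hp : 0 < 2 * Real.pi := by positivity
  have h3 := hasSum_le (fun n => mul_le_mul_of_nonneg_left (hdv n) hp.le) h1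
    (hv.hasSum.mul_left (2 * Real.pi))
  refine abs_le_of_sq_le_sq' ?_ (by positivity) |>.2
  rw [mul_pow, Real.sq_sqrt (tsum_nonneg fun n => (sq_nonneg _).trans (hdv n))]
  nlinarith

theorem norm_ofReal_pow_le_one {ρ : ℝ} (hρ : ρ ∈ Set.Ico (0:ℝ) 1) (n : ℕ) : ‖(ρ : ℂ) ^ n‖ ≤ 1 := by
  rw [norm_pow, Complex.norm_real, Real.norm_of_nonneg hρ.1]
  exact pow_le_one₀ hρ.1 hρ.2.le

theorem tendsto_ofReal_pow_one (n : ℕ) :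
    Tendsto (fun ρ : ℝ => (ρ : ℂ) ^ n) (nhdsWithin 1 (Set.Iio 1)) (nhds 1) := by
  have : Continuous fun ρ : ℝ => (ρ : ℂ) ^ n := by fun_prop
  simpa using (this.tendsto 1).mono_left (nhdsWithin_le_nhds (s := Set.Iio (1:ℝ)))

theorem eventually_mem_Ico : ∀ᶠ ρ : ℝ in nhdsWithin 1 (Set.Iio 1), ρ ∈ Set.Ico (0:ℝ) 1 := by
  filter_upwards [Ioo_mem_nhdsLT (show (0 : ℝ) < 1 by norm_num)] with ρ hρ
  exact ⟨hρ.1.le, hρ.2⟩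

theorem boundedVariationOn_primitive {c : ℕ → ℂ} (hc : Summable fun n => ‖c n‖ ^ 2) :
    BoundedVariationOn (fun t : ℝ => ∑' n : ℕ, c n / n * uc t ^ n) (Set.Icc 0 (2 * Real.pi)) := by
  have he := summable_norm_div_nat hc
  set c' : ℕ → ℂ := fun n => n * (c n / n) with hc'
  have hc's : Summable fun n => ‖c' n‖ ^ 2 := by
    refine Summable.of_nonneg_of_le (fun n => sq_nonneg _) (fun n => ?_) hc
    rcases eq_or_ne n 0 with rfl | hn
    · simp [hc']
    · have : (n : ℂ) ≠ 0 := by exact_mod_cast hn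
      simp [hc', mul_div_cancel₀ _ this]
  set M := 2 * Real.pi * Real.sqrt (∑' n, ‖c' n‖ ^ 2)
  have hle : eVariationOn (fun t : ℝ => ∑' n : ℕ, c n / n * uc t ^ n) (Set.Icc 0 (2 * Real.pi))
      ≤ ENNReal.ofReal M := by
    by_contra! hlt
    have hT : ∀ t ∈ Set.Icc 0 (2 * Real.pi),
        Tendsto (fun ρ : ℝ => ∑' n : ℕ, (c n / n * (ρ : ℂ) ^ n) * uc t ^ n)
          (nhdsWithin 1 (Set.Iio 1)) (nhds (∑' n : ℕ, c n / n * uc t ^ n)) := fun t _ => by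
      refine tendsto_tsum_of_dominated_convergence he (fun n => ?_) ?_
      · simpa using ((tendsto_ofReal_pow_one n).const_mul (c n / n)).mul_const (uc t ^ n)
      · filter_upwards [eventually_mem_Ico] with ρ hρ n
        rw [norm_mul, norm_mul, norm_pow (uc t), uc_norm, one_pow, mul_one]
        exact mul_le_of_le_one_right (norm_nonneg _) (norm_ofReal_pow_le_one hρ n)
    obtain ⟨ρ, hρ, hv⟩ := (eventually_mem_Ico.and
      (eVariationOn.lowerSemicontinuous_aux hT hlt)).exists
    have hs := summable_coeff_mul_pow hc's hρ
    have hse : Summable fun n : ℕ => ‖c n / n * (ρ : ℂ) ^ n‖ := by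
      refine Summable.of_nonneg_of_le (fun n => norm_nonneg _) (fun n => ?_) he
      rw [norm_mul]
      exact mul_le_of_le_one_right (norm_nonneg _) (norm_ofReal_pow_le_one hρ n)
    have hsum : ∀ t, Summable fun n : ℕ => c n / n * (ρ : ℂ) ^ n * uc t ^ n := fun t =>
      (hse.congr fun n => by simp [uc_norm]).of_norm
    refine absurd (eVariationOn_Icc_le_of_norm_sub_le
      (w := fun t => ‖∑' n, (c' n * (ρ : ℂ) ^ n) * uc t ^ n‖)
      (F := fun t => ∑' n : ℕ, (c n / n * (ρ : ℂ) ^ n) * uc t ^ n)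
      (continuous_fourier_tsum hs).norm (fun t => norm_nonneg _) (a := 0) (b := 2 * Real.pi)
      fun x y hxy => ?_) (not_le.2 (lt_of_le_of_lt (ENNReal.ofReal_le_ofReal
        (integral_norm_fourier_tsum_le hs hc's fun n => by
          rw [norm_mul]
          gcongr
          exact mul_le_of_le_one_right (norm_nonneg _) (norm_ofReal_pow_le_one hρ n))) hv))
    have h1 := hasSum_integral_mul_series (a := x) (b := y) (g := fun _ => Complex.I)
      (continuous_const.intervalIntegrable _ _) (u := fun n t => uc t ^ n)
      (fun n => continuous_uc.pow n) (fun n t => by simp [uc_norm]) hs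
    have h2 : ∀ n : ℕ, c' n * (ρ : ℂ) ^ n * ∫ t in x..y, Complex.I * uc t ^ n
        = c n / n * (ρ : ℂ) ^ n * uc y ^ n - c n / n * (ρ : ℂ) ^ n * uc x ^ n := fun n => by
      rw [← mul_sub, ← integral_I_mul_uc_pow]; simp only [hc']; ring
    simp_rw [h2] at h1
    have h3 := h1.unique ((hsum y).hasSum.sub (hsum x).hasSum)
    rw [← h3]
    refine (intervalIntegral.norm_integral_le_integral_norm hxy).trans (le_of_eq ?_)
    simp
  exact ne_top_of_le_ne_top ENNReal.ofReal_ne_top hle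

/-- **Fatou's theorem** for square summable power series. -/
theorem ae_exists_radial_limit {c : ℕ → ℂ} (hc : Summable fun n => ‖c n‖ ^ 2) :
    ∀ᵐ θ : ℝ, θ ∈ Set.uIcc 0 (2 * Real.pi) → ∃ L, Tendsto
      (fun ρ : ℝ => diskSum c ((ρ : ℂ) * uc θ)) (nhdsWithin 1 (Set.Iio 1)) (nhds L) := by
  have hbv := boundedVariationOn_primitive hc
  rw [← Set.uIcc_of_le (by positivity)] at hbv
  filter_upwards [hbv.ae_differentiableAt_of_mem_uIcc] with θ hθ hmem
  obtain ⟨L, hL⟩ := exists_radial_limit_of_differentiableAt (summable_norm_div_nat hc) (hθ hmem)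
  refine ⟨L + c 0, (hL.add_const (c 0)).congr' ?_⟩
  filter_upwards [eventually_mem_Ico] with ρ hρ
  have hs : Summable fun n => c n * ((ρ : ℂ) * uc θ) ^ n :=
    ((summable_coeff_mul_pow hc hρ).congr fun n => by simp [uc_norm, mul_pow]).of_norm
  have e : ∀ n : ℕ, (n : ℂ) * (c n / n) * ((ρ : ℂ) * uc θ) ^ n
      = if n = 0 then 0 else c n * ((ρ : ℂ) * uc θ) ^ n := fun n => by
    split_ifs with hn
    · simp [hn]
    · rw [mul_div_cancel₀ _ (show (n : ℂ) ≠ 0 by exact_mod_cast hn)]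
  rw [diskSum, hs.tsum_eq_add_tsum_ite 0]
  simp_rw [e]
  simp [add_comm]

theorem continuous_diskSum_mul_uc {c : ℕ → ℂ} (hc : Summable fun n => ‖c n‖ ^ 2) {ρ : ℝ}
    (hρ : ρ ∈ Set.Ico (0:ℝ) 1) : Continuous fun θ : ℝ => diskSum c ((ρ : ℂ) * uc θ) := by
  simp_rw [diskSum_ofReal_mul_uc]
  exact continuous_fourier_tsum (summable_coeff_mul_pow hc hρ)

/-- The boundary function of a square summable power series is integrable and has vanishing
negative Fourier coefficients. -/
theorem radial_limit_integrable_and_integral_eq_zero {c : ℕ → ℂ} (hc : Summable fun n => ‖c n‖ ^ 2)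
    {H : ℝ → ℂ}
    (hH : ∀ᵐ θ : ℝ, θ ∈ Set.uIcc 0 (2 * Real.pi) → Tendsto
      (fun ρ : ℝ => diskSum c ((ρ : ℂ) * uc θ)) (nhdsWithin 1 (Set.Iio 1)) (nhds (H θ))) :
    IntervalIntegrable H volume 0 (2 * Real.pi) ∧
      ∀ n : ℕ, ∫ θ in (0:ℝ)..(2 * Real.pi), H θ * uc θ ^ (n + 1) = 0 := by
  have hp : (0:ℝ) ≤ 2 * Real.pi := by positivity
  set μ : Measure ℝ := volume.restrict (Set.Ioc 0 (2 * Real.pi)) with hμ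
  set σ : ℕ → ℝ := fun k => 1 - 1 / ((k : ℝ) + 1) with hσ
  have hσI : ∀ k, σ k ∈ Set.Ico (0:ℝ) 1 := fun k => by
    have h1 : (1:ℝ) ≤ (k:ℝ) + 1 := by linarith [Nat.cast_nonneg (α := ℝ) k]
    have h2 : 1 / ((k:ℝ) + 1) ≤ 1 := by rw [div_le_one (by linarith)]; exact h1
    have h3 : 0 < 1 / ((k:ℝ) + 1) := by positivity
    exact ⟨by simp only [hσ]; linarith, by simp only [hσ]; linarith⟩
  have hσt : Tendsto σ atTop (nhdsWithin 1 (Set.Iio 1)) := by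
    refine tendsto_nhdsWithin_iff.2 ⟨?_, Eventually.of_forall fun k => (hσI k).2⟩
    simpa [hσ] using (tendsto_one_div_add_atTop_nhds_zero_nat (𝕜 := ℝ)).const_sub 1
  set S : ℕ → ℝ → ℂ := fun k θ => diskSum c ((σ k : ℂ) * uc θ) with hS
  have hSc : ∀ k, Continuous (S k) := fun k => continuous_diskSum_mul_uc hc (hσI k)
  have hlim : ∀ᵐ θ ∂μ, Tendsto (fun k => S k θ) atTop (nhds (H θ)) := by
    rw [hμ, ae_restrict_iff' measurableSet_Ioc]
    filter_upwards [hH] with θ hθ hm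
    exact (hθ (by rw [Set.uIcc_of_le hp]; exact Set.Ioc_subset_Icc_self hm)).comp hσt
  have hHm : AEStronglyMeasurable H μ :=
    aestronglyMeasurable_of_tendsto_ae atTop (fun k => (hSc k).aestronglyMeasurable) hlim
  set ε : ℕ → ℝ := fun k => 2 * Real.pi * Real.sqrt (∑' n, ‖c n‖ ^ 2 * (1 - σ k ^ n) ^ 2)
  have hpow : ∀ k n, (1 - σ k ^ n) ^ 2 ≤ 1 := fun k n => by
    have h1 := pow_nonneg (hσI k).1 n
    have h2 := pow_le_one₀ (n := n) (hσI k).1 (hσI k).2.le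
    nlinarith
  have hvs : ∀ k, Summable fun n => ‖c n‖ ^ 2 * (1 - σ k ^ n) ^ 2 := fun k =>
    Summable.of_nonneg_of_le (fun n => by positivity)
      (fun n => mul_le_of_le_one_right (sq_nonneg _) (hpow k n)) hc
  have hε0 : Tendsto ε atTop (nhds 0) := by
    have h1 : Tendsto (fun k => ∑' n, ‖c n‖ ^ 2 * (1 - σ k ^ n) ^ 2) atTop
        (nhds (∑' n, ‖c n‖ ^ 2 * (1 - 1 ^ n) ^ 2)) := by
      refine tendsto_tsum_of_dominated_convergence hc (fun n => ?_)
        (Eventually.of_forall fun k n => ?_)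
      · exact ((((tendsto_nhds_of_tendsto_nhdsWithin hσt).pow n).const_sub 1).pow 2).const_mul _
      · rw [Real.norm_of_nonneg (by positivity)]
        exact mul_le_of_le_one_right (sq_nonneg _) (hpow k n)
    have h2 := (h1.sqrt).const_mul (2 * Real.pi)
    simpa using h2
  have hdiff : ∀ j k, k ≤ j → ∫⁻ θ, ‖S j θ - S k θ‖ₑ ∂μ ≤ ENNReal.ofReal (ε k) := fun j k hjk => by
    have hmono : σ k ≤ σ j := by
      have : 1 / ((j:ℝ) + 1) ≤ 1 / ((k:ℝ) + 1) :=
        one_div_le_one_div_of_le (by positivity) (by gcongr)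
      simp only [hσ]; linarith
    have hsj := summable_coeff_mul_pow hc (hσI j)
    have hsk := summable_coeff_mul_pow hc (hσI k)
    have e : ∀ θ, S j θ - S k θ
        = ∑' n, (c n * (σ j : ℂ) ^ n - c n * (σ k : ℂ) ^ n) * uc θ ^ n := fun θ => by
      simp only [hS, diskSum_ofReal_mul_uc, sub_mul]
      refine (Summable.tsum_sub ?_ ?_).symm
      · exact (hsj.congr fun n => by simp [uc_norm]).of_norm
      · exact (hsk.congr fun n => by simp [uc_norm]).of_norm
    have hds : Summable fun n => ‖c n * (σ j : ℂ) ^ n - c n * (σ k : ℂ) ^ n‖ :=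
      Summable.of_nonneg_of_le (fun n => norm_nonneg _) (fun n => norm_sub_le _ _) (hsj.add hsk)
    have h1 := integral_norm_fourier_tsum_le hds (hvs k) fun n => by
      rw [← mul_sub, norm_mul, mul_pow]
      refine mul_le_mul_of_nonneg_left ?_ (sq_nonneg _)
      rw [← Complex.ofReal_pow, ← Complex.ofReal_pow, ← Complex.ofReal_sub, Complex.norm_real,
        Real.norm_eq_abs, sq_abs]
      have h2 := pow_le_pow_left₀ (hσI k).1 hmono n
      have h3 := pow_le_one₀ (n := n) (hσI j).1 (hσI j).2.le
      nlinarith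
    simp_rw [← e] at h1
    rw [intervalIntegral.integral_of_le hp] at h1
    have hi : Integrable (fun θ => S j θ - S k θ) μ :=
      (((hSc j).sub (hSc k)).intervalIntegrable 0 (2 * Real.pi)).1
    rw [← ofReal_integral_norm_eq_lintegral_enorm hi]
    exact ENNReal.ofReal_le_ofReal h1
  have hfat : ∀ k, ∫⁻ θ, ‖S k θ - H θ‖ₑ ∂μ ≤ ENNReal.ofReal (ε k) := fun k => by
    have h1 : ∫⁻ θ, ‖S k θ - H θ‖ₑ ∂μ = ∫⁻ θ, liminf (fun j => ‖S j θ - S k θ‖ₑ) atTop ∂μ := by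
      refine lintegral_congr_ae ?_
      filter_upwards [hlim] with θ hθ
      rw [((hθ.sub_const (S k θ)).enorm).liminf_eq, ← enorm_neg, neg_sub]
    rw [h1]
    refine (lintegral_liminf_le fun j => ((hSc j).sub (hSc k)).enorm.measurable).trans ?_
    refine Filter.liminf_le_of_frequently_le' (Eventually.frequently ?_)
    filter_upwards [eventually_ge_atTop k] with j hj
    exact hdiff j k hj
  have hSi : ∀ k, Integrable (S k) μ := fun k =>
    ((hSc k).intervalIntegrable 0 (2 * Real.pi)).1
  have hHi : Integrable H μ := by
    have h0 : Integrable (fun θ => S 0 θ - H θ) μ :=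
      ⟨(hSc 0).aestronglyMeasurable.sub hHm, (hfat 0).trans_lt ENNReal.ofReal_lt_top⟩
    exact ((hSi 0).sub h0).congr (ae_of_all _ fun θ => sub_sub_cancel _ _)
  refine ⟨(intervalIntegrable_iff_integrableOn_Ioc_of_le hp).2 hHi, fun n => ?_⟩
  have hucm : AEStronglyMeasurable (fun θ => uc θ ^ (n + 1)) μ :=
    (continuous_uc.pow _).aestronglyMeasurable
  have h_integral := tendsto_integral_of_L1 (μ := μ) (l := atTop) (fun θ => H θ * uc θ ^ (n + 1))
    (hHm.mul hucm) (F := fun k θ => S k θ * uc θ ^ (n + 1))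
    (Eventually.of_forall fun k => (hSi k).mul_bdd hucm (c := 1)
      (ae_of_all _ fun θ => by simp [uc_norm])) (by
      refine tendsto_of_tendsto_of_tendsto_of_le_of_le tendsto_const_nhds
        (ENNReal.ofReal_zero ▸ ENNReal.tendsto_ofReal hε0) (fun k => zero_le) fun k => ?_
      refine le_trans (le_of_eq (lintegral_congr fun θ => ?_)) (hfat k)
      rw [← sub_mul, enorm_mul, enorm_pow, ← ofReal_norm (uc θ), uc_norm]
      simp)
  rw [intervalIntegral.integral_of_le hp]
  refine tendsto_nhds_unique h_integral ?_
  have hz : ∀ k, ∫ θ in Set.Ioc 0 (2 * Real.pi), S k θ * uc θ ^ (n + 1) = 0 := fun k => by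
    rw [← intervalIntegral.integral_of_le hp]
    have h1 := hasSum_integral_mul_series (a := 0) (b := 2 * Real.pi)
      (g := fun θ => uc θ ^ (n + 1)) ((continuous_uc.pow _).intervalIntegrable _ _)
      (u := fun n t => uc t ^ n) (fun n => continuous_uc.pow n) (fun n t => by simp [uc_norm])
      (summable_coeff_mul_pow hc (hσI k))
    have h2 : ∀ m : ℕ, ∫ θ in (0:ℝ)..(2 * Real.pi), uc θ ^ (n + 1) * uc θ ^ m = 0 := fun m => by
      simpa [pow_add] using integral_uc_pow 0 (n + 1 + m) (by omega)
    simp_rw [h2, mul_zero] at h1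
    rw [← h1.unique hasSum_zero]
    simp only [hS, diskSum_ofReal_mul_uc, mul_comm (uc _ ^ (n + 1))]
  exact tendsto_const_nhds.congr fun k => (hz k).symm

theorem MemH2.ae_tendsto_bdry {h : ℂ → ℂ} (hh : MemH2 h) :
    ∀ᵐ θ : ℝ, θ ∈ Set.uIcc 0 (2 * Real.pi) → Tendsto (fun ρ : ℝ => h ((ρ : ℂ) * uc θ))
      (nhdsWithin 1 (Set.Iio 1)) (nhds (bdry h θ)) := by
  obtain ⟨c, hc, hs⟩ := exists_sq_summable_coeff hh
  filter_upwards [ae_exists_radial_limit hc] with θ hθ hm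
  obtain ⟨L, hL⟩ := hθ hm
  have hL' : Tendsto (fun ρ : ℝ => h ((ρ : ℂ) * uc θ)) (nhdsWithin 1 (Set.Iio 1)) (nhds L) := by
    refine hL.congr' ?_
    filter_upwards [eventually_mem_Ico] with ρ hρ
    rw [hs _ (ofReal_mul_uc_mem hρ θ)]
  rwa [bdry, radLim, hL'.limUnder_eq]

theorem MemH2.bdry_integrable_and_integral_eq_zero {h : ℂ → ℂ} (hh : MemH2 h) :
    IntervalIntegrable (bdry h) volume 0 (2 * Real.pi) ∧
      ∀ n : ℕ, ∫ θ in (0:ℝ)..(2 * Real.pi), bdry h θ * uc θ ^ (n + 1) = 0 := by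
  obtain ⟨c, hc, hs⟩ := exists_sq_summable_coeff hh
  refine radial_limit_integrable_and_integral_eq_zero hc ?_
  filter_upwards [hh.ae_tendsto_bdry] with θ hθ hm
  refine (hθ hm).congr' ?_
  filter_upwards [eventually_mem_Ico] with ρ hρ
  rw [hs _ (ofReal_mul_uc_mem hρ θ)]

/-- `G` is analytic in the disk, uniformly bounded on circles close to the boundary, and has radial
limits `Gs` almost everywhere. -/
def HasBoundaryValues (G : ℂ → ℂ) (Gs : ℝ → ℂ) : Prop :=
  DifferentiableOn ℂ G unitDisk ∧
    (∀ᵐ θ : ℝ, θ ∈ Set.uIcc 0 (2 * Real.pi) →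
      Tendsto (fun ρ : ℝ => G ((ρ : ℂ) * uc θ)) (nhdsWithin 1 (Set.Iio 1)) (nhds (Gs θ))) ∧
    ∃ C : ℝ, ∀ᶠ ρ : ℝ in nhdsWithin 1 (Set.Iio 1), ∀ θ, ‖G ((ρ : ℂ) * uc θ)‖ ≤ C

theorem HasBoundaryValues.mul {G G' : ℂ → ℂ} {Gs Gs' : ℝ → ℂ} (h : HasBoundaryValues G Gs)
    (h' : HasBoundaryValues G' Gs') :
    HasBoundaryValues (fun z => G z * G' z) (fun θ => Gs θ * Gs' θ) := by
  obtain ⟨hd, hl, C, hC⟩ := h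
  obtain ⟨hd', hl', C', hC'⟩ := h'
  refine ⟨hd.mul hd', ?_, C * C', ?_⟩
  · filter_upwards [hl, hl'] with θ h1 h2 hm
    exact (h1 hm).mul (h2 hm)
  · filter_upwards [hC, hC'] with ρ h1 h2 θ
    rw [norm_mul]
    exact mul_le_mul (h1 θ) (h2 θ) (norm_nonneg _) ((norm_nonneg _).trans (h1 θ))

theorem tendsto_ofReal_mul (w : ℂ) :
    Tendsto (fun ρ : ℝ => (ρ : ℂ) * w) (nhdsWithin 1 (Set.Iio 1)) (nhds w) := by
  simpa using (tendsto_ofReal_pow_one 1).mul_const w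

theorem hasBoundaryValues_of_differentiableAt {V : ℂ → ℂ}
    (hV : ∀ z, ‖z‖ ≤ 1 → DifferentiableAt ℂ V z) : HasBoundaryValues V fun θ => V (uc θ) := by
  have hc : ContinuousOn V (Metric.closedBall 0 1) := fun z hz =>
    (hV z (by simpa using hz)).continuousAt.continuousWithinAt
  obtain ⟨C, hC⟩ := (isCompact_closedBall (0:ℂ) 1).exists_bound_of_continuousOn hc
  refine ⟨fun z hz => (hV z ?_).differentiableWithinAt, ae_of_all _ fun θ _ => ?_, C, ?_⟩
  · rw [unitDisk, mem_ball_zero_iff] at hz; exact hz.le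
  · exact (hV _ (uc_norm θ).le).continuousAt.tendsto.comp (tendsto_ofReal_mul _)
  · filter_upwards [eventually_mem_Ico] with ρ hρ θ
    refine hC _ ?_
    rw [mem_closedBall_zero_iff, norm_ofReal_mul_uc hρ.1]
    exact hρ.2.le

/-- A function with vanishing Fourier coefficients of nonpositive index is annihilated by the
boundary values of every bounded analytic function. -/
theorem HasBoundaryValues.integral_mul_eq_zero {G : ℂ → ℂ} {Gs : ℝ → ℂ}
    (hG : HasBoundaryValues G Gs)
    {φ : ℝ → ℂ} (hφ : IntervalIntegrable φ volume 0 (2 * Real.pi))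
    (hφ0 : ∀ n : ℕ, ∫ θ in (0:ℝ)..(2 * Real.pi), φ θ * uc θ ^ n = 0) :
    IntervalIntegrable (fun θ => Gs θ * φ θ) volume 0 (2 * Real.pi) ∧
      ∫ θ in (0:ℝ)..(2 * Real.pi), Gs θ * φ θ = 0 := by
  obtain ⟨hG, hGs, C, hC⟩ := hG
  obtain ⟨c, hc, hs⟩ := exists_coeff hG
  have hcont : ∀ ρ ∈ Set.Ico (0:ℝ) 1, Continuous fun θ : ℝ => G ((ρ : ℂ) * uc θ) := fun ρ hρ => by
    simp_rw [hs _ (ofReal_mul_uc_mem hρ _), diskSum_ofReal_mul_uc]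
    exact continuous_fourier_tsum (hc ρ hρ)
  have hT : Tendsto (fun ρ : ℝ => ∫ θ in (0:ℝ)..(2 * Real.pi), G ((ρ : ℂ) * uc θ) * φ θ)
      (nhdsWithin 1 (Set.Iio 1)) (nhds (∫ θ in (0:ℝ)..(2 * Real.pi), Gs θ * φ θ)) := by
    refine intervalIntegral.tendsto_integral_filter_of_dominated_convergence (fun θ => C * ‖φ θ‖)
      ?_ ?_ (hφ.norm.const_mul C) ?_
    · filter_upwards [eventually_mem_Ico] with ρ hρ
      exact (hcont ρ hρ).aestronglyMeasurable.mul hφ.aestronglyMeasurable_restrict_uIoc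
    · filter_upwards [hC] with ρ hρ
      refine ae_of_all _ fun θ _ => ?_
      rw [norm_mul]
      exact mul_le_mul_of_nonneg_right (hρ θ) (norm_nonneg _)
    · filter_upwards [hGs] with θ hθ hm
      exact (hθ (Set.uIoc_subset_uIcc hm)).mul_const _
  have hz : ∀ᶠ ρ : ℝ in nhdsWithin 1 (Set.Iio 1),
      ∫ θ in (0:ℝ)..(2 * Real.pi), G ((ρ : ℂ) * uc θ) * φ θ = 0 := by
    filter_upwards [eventually_mem_Ico] with ρ hρ
    have h1 := hasSum_integral_mul_series hφ (u := fun n t => uc t ^ n)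
      (fun n => continuous_uc.pow n) (fun n t => by simp [uc_norm]) (hc ρ hρ)
    simp_rw [hφ0, mul_zero] at h1
    rw [← h1.unique hasSum_zero]
    refine intervalIntegral.integral_congr fun θ _ => ?_
    simp only [hs _ (ofReal_mul_uc_mem hρ θ), diskSum_ofReal_mul_uc]
    exact mul_comm _ _
  refine ⟨(hφ.norm.const_mul C).mono_fun' (.mul ?_ hφ.aestronglyMeasurable_restrict_uIoc) ?_,
    tendsto_nhds_unique hT (tendsto_const_nhds.congr' (hz.mono fun _ h => h.symm))⟩
  · classical
    refine aestronglyMeasurable_of_tendsto_ae (nhdsWithin (1:ℝ) (Set.Iio 1))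
      (f := fun ρ θ => if ρ ∈ Set.Ico (0:ℝ) 1 then G ((ρ : ℂ) * uc θ) else 0) (fun ρ => ?_) ?_
    · by_cases hρ : ρ ∈ Set.Ico (0:ℝ) 1
      · simp only [hρ, if_true]
        exact (hcont ρ hρ).aestronglyMeasurable
      · simp only [hρ, if_false]
        exact aestronglyMeasurable_const
    · rw [ae_restrict_iff' measurableSet_uIoc]
      filter_upwards [hGs] with θ hθ hm
      refine (hθ (Set.uIoc_subset_uIcc hm)).congr' ?_
      filter_upwards [eventually_mem_Ico] with ρ hρ
      simp only [hρ, if_true]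
  · rw [EventuallyLE, ae_restrict_iff' measurableSet_uIoc]
    filter_upwards [hGs] with θ hθ hm
    rw [norm_mul]
    refine mul_le_mul_of_nonneg_right ?_ (norm_nonneg _)
    exact le_of_tendsto (hθ (Set.uIoc_subset_uIcc hm)).norm (hC.mono fun ρ h => h θ)

/-- The Blaschke factor with the real zero `r`. -/
def blaschkeFactor (r : ℝ) (z : ℂ) : ℂ := (z - r) / (1 - r * z)

theorem norm_one_add_le_two_mul {r : ℝ} (hr : r ∈ Set.Ioo (-1 : ℝ) 0) {z : ℂ} (hz : ‖z‖ ≤ 1) :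
    ‖1 + z‖ ≤ 2 * ‖1 - r * z‖ := by
  have h1 : ‖1 + z‖ ≤ ‖1 - r * z‖ + (1 + r) * ‖z‖ := by
    have e : 1 + z = (1 - r * z) + ((1 + r : ℝ) : ℂ) * z := by push_cast; ring
    rw [e]
    refine (norm_add_le _ _).trans_eq ?_
    rw [norm_mul, Complex.norm_real, Real.norm_of_nonneg (by linarith [hr.1])]
  have h2 : 1 - (-r) * ‖z‖ ≤ ‖1 - r * z‖ := by
    have := norm_sub_norm_le (1 : ℂ) (r * z)
    rwa [norm_one, norm_mul, Complex.norm_real, Real.norm_of_nonpos hr.2.le] at this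
  nlinarith [hr.1, hr.2, norm_nonneg z]

theorem one_sub_mul_ne_zero {r : ℝ} (hr : r ∈ Set.Ioo (-1 : ℝ) 0) {z : ℂ} (hz : ‖z‖ ≤ 1) :
    1 - r * z ≠ 0 := by
  have := norm_sub_norm_le (1 : ℂ) (r * z)
  rw [norm_one, norm_mul, Complex.norm_real, Real.norm_of_nonpos hr.2.le] at this
  rw [← norm_pos_iff]
  nlinarith [hr.1, hr.2, norm_nonneg z]

theorem blaschkeFactor_eq_one_add {r : ℝ} (hr : r ∈ Set.Ioo (-1 : ℝ) 0) {z : ℂ} (hz : ‖z‖ ≤ 1) :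
    blaschkeFactor r z = 1 + (1 + r) * (z - 1) / (1 - r * z) := by
  have := one_sub_mul_ne_zero hr hz
  rw [blaschkeFactor, div_eq_iff this, add_mul, div_mul_cancel₀ _ this]
  ring

theorem norm_blaschkeFactor_le_one {r : ℝ} (hr : r ∈ Set.Ioo (-1 : ℝ) 0) {z : ℂ} (hz : ‖z‖ ≤ 1) :
    ‖blaschkeFactor r z‖ ≤ 1 := by
  rw [blaschkeFactor, norm_div, div_le_one (norm_pos_iff.2 (one_sub_mul_ne_zero hr hz))]
  have hz2 : z.re * z.re + z.im * z.im ≤ 1 := by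
    rw [← Complex.normSq_apply, Complex.normSq_eq_norm_sq]
    exact pow_le_one₀ (norm_nonneg _) hz
  rw [← sq_le_sq₀ (norm_nonneg _) (norm_nonneg _), ← Complex.normSq_eq_norm_sq,
    ← Complex.normSq_eq_norm_sq, Complex.normSq_apply, Complex.normSq_apply]
  simp
  nlinarith [mul_nonneg (show 0 ≤ 1 - r * r by nlinarith [hr.1, hr.2]) (sub_nonneg.2 hz2)]

theorem norm_blaschkeFactor_eq_one {r : ℝ} (hr : r ∈ Set.Ioo (-1 : ℝ) 0) {z : ℂ} (hz : ‖z‖ = 1) :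
    ‖blaschkeFactor r z‖ = 1 := by
  rw [blaschkeFactor, norm_div, div_eq_one_iff_eq (norm_ne_zero_iff.2 (one_sub_mul_ne_zero hr hz.le))]
  have hz2 : z.re * z.re + z.im * z.im = 1 := by
    rw [← Complex.normSq_apply, Complex.normSq_eq_norm_sq, hz, one_pow]
  rw [← sq_eq_sq₀ (norm_nonneg _) (norm_nonneg _), ← Complex.normSq_eq_norm_sq,
    ← Complex.normSq_eq_norm_sq, Complex.normSq_apply, Complex.normSq_apply]
  simp
  linear_combination (1 - r * r) * hz2

theorem norm_blaschkeFactor_sub_one_le {r : ℝ} (hr : r ∈ Set.Ioo (-1 : ℝ) 0) {z : ℂ}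
    (hz : ‖z‖ ≤ 1) {δ : ℝ} (hδ : 0 < δ) (hzδ : δ ≤ ‖1 - r * z‖) :
    ‖(1 + r) * (z - 1) / (1 - r * z)‖ ≤ (1 + r) * (2 / δ) := by
  have e : (1 + r : ℂ) = ((1 + r : ℝ) : ℂ) := by push_cast; ring
  rw [norm_div, norm_mul, e, Complex.norm_real, Real.norm_of_nonneg (by linarith [hr.1]), mul_div_assoc]
  refine mul_le_mul_of_nonneg_left ?_ (by linarith [hr.1])
  have : ‖z - 1‖ ≤ 2 := (norm_sub_le _ _).trans (by rw [norm_one]; linarith)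
  gcongr

section Blaschke

variable {r : ℕ → ℝ}

theorem multipliable_blaschkeFactor (hr : ∀ n, r n ∈ Set.Ioo (-1 : ℝ) 0)
    (hs : Summable fun n => 1 + r n) {z : ℂ} (hz : ‖z‖ ≤ 1) (hz1 : 1 + z ≠ 0) :
    Multipliable fun n => blaschkeFactor (r n) z := by
  simp_rw [fun n => blaschkeFactor_eq_one_add (hr n) hz]
  refine multipliable_one_add_of_summable ?_
  have hp : 0 < ‖1 + z‖ / 2 := half_pos (norm_pos_iff.2 hz1)
  refine Summable.of_nonneg_of_le (fun n => norm_nonneg _) (fun n => ?_) (hs.mul_right (2 / (‖1 + z‖ / 2)))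
  exact norm_blaschkeFactor_sub_one_le (hr n) hz hp
    (by linarith [norm_one_add_le_two_mul (hr n) hz])

theorem one_add_ne_zero_of_norm_lt {z : ℂ} (hz : ‖z‖ < 1) : 1 + z ≠ 0 := fun h => by
  rw [← eq_neg_iff_add_eq_zero] at h
  rw [← norm_neg, ← h, norm_one] at hz
  exact lt_irrefl _ hz

theorem norm_tprod_blaschkeFactor_le_one (hr : ∀ n, r n ∈ Set.Ioo (-1 : ℝ) 0)
    (hs : Summable fun n => 1 + r n) {z : ℂ} (hz : ‖z‖ < 1) :
    ‖∏' n, blaschkeFactor (r n) z‖ ≤ 1 := by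
  refine le_of_tendsto (multipliable_blaschkeFactor hr hs hz.le
    (one_add_ne_zero_of_norm_lt hz)).hasProd.norm (Eventually.of_forall fun s => ?_)
  exact Finset.prod_le_one (fun i _ => norm_nonneg _)
    fun i _ => norm_blaschkeFactor_le_one (hr i) hz.le

theorem norm_tprod_blaschkeFactor_eq_one (hr : ∀ n, r n ∈ Set.Ioo (-1 : ℝ) 0)
    (hs : Summable fun n => 1 + r n) {z : ℂ} (hz : ‖z‖ = 1) (hz1 : 1 + z ≠ 0) :
    ‖∏' n, blaschkeFactor (r n) z‖ = 1 := by
  rw [(multipliable_blaschkeFactor hr hs hz.le hz1).norm_tprod]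
  simp_rw [fun n => norm_blaschkeFactor_eq_one (hr n) hz, tprod_one]

theorem differentiableOn_tprod_blaschkeFactor (hr : ∀ n, r n ∈ Set.Ioo (-1 : ℝ) 0)
    (hs : Summable fun n => 1 + r n) :
    DifferentiableOn ℂ (fun z => ∏' n, blaschkeFactor (r n) z) unitDisk := by
  intro z hz
  rw [unitDisk, mem_ball_zero_iff] at hz
  obtain ⟨R, hzR, hR⟩ := exists_between hz
  have hball : ∀ w ∈ Metric.ball (0:ℂ) R, ‖w‖ ≤ 1 := fun w hw => by
    rw [mem_ball_zero_iff] at hw; linarith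
  have hd : ∀ n, DifferentiableOn ℂ (fun w : ℂ => (1 + r n) * (w - 1) / (1 - r n * w))
      (Metric.ball (0:ℂ) R) := fun n => by
    refine DifferentiableOn.div (by fun_prop) (by fun_prop) fun w hw =>
      one_sub_mul_ne_zero (hr n) (hball w hw)
  have hprod := Summable.hasProdLocallyUniformlyOn_nat_one_add
    (K := Metric.ball (0:ℂ) R) (f := fun n (w : ℂ) => (1 + r n) * (w - 1) / (1 - r n * w))
    Metric.isOpen_ball (hs.mul_right (2 / ((1 - R) / 2))) (Eventually.of_forall fun n w hw => by
      refine norm_blaschkeFactor_sub_one_le (hr n) (hball w hw) (by linarith) ?_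
      have h1 := norm_one_add_le_two_mul (hr n) (hball w hw)
      have h2 := norm_sub_norm_le (1 : ℂ) (-w)
      rw [sub_neg_eq_add, norm_neg, norm_one] at h2
      rw [mem_ball_zero_iff] at hw
      linarith) fun n => (hd n).continuousOn
  have hdiff : DifferentiableOn ℂ (fun w : ℂ => ∏' n, (1 + (1 + r n) * (w - 1) / (1 - r n * w)))
      (Metric.ball (0:ℂ) R) := by
    refine hprod.differentiableOn (Eventually.of_forall fun s => ?_) Metric.isOpen_ball
    exact DifferentiableOn.fun_finsetProd fun n _ => (hd n).const_add 1
  have hnhds : Metric.ball (0:ℂ) R ∈ nhds z :=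
    Metric.isOpen_ball.mem_nhds (by rwa [mem_ball_zero_iff])
  refine ((hdiff.differentiableAt hnhds).congr_of_eventuallyEq ?_).differentiableWithinAt
  filter_upwards [hnhds] with w hw
  simp_rw [fun n => blaschkeFactor_eq_one_add (hr n) (hball w hw)]

theorem tendsto_tprod_blaschkeFactor (hr : ∀ n, r n ∈ Set.Ioo (-1 : ℝ) 0)
    (hs : Summable fun n => 1 + r n) {w : ℂ} (hw : ‖w‖ = 1) (hw1 : 1 + w ≠ 0) :
    Tendsto (fun ρ : ℝ => ∏' n, blaschkeFactor (r n) ((ρ : ℂ) * w)) (nhdsWithin 1 (Set.Iio 1))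
      (nhds (∏' n, blaschkeFactor (r n) w)) := by
  have hnorm : ∀ ρ ∈ Set.Ico (0:ℝ) 1, ‖(ρ : ℂ) * w‖ ≤ 1 := fun ρ hρ => by
    rw [norm_mul, hw, mul_one, Complex.norm_real, Real.norm_of_nonneg hρ.1]; exact hρ.2.le
  have ht : Tendsto (fun ρ : ℝ => (ρ : ℂ) * w) (nhdsWithin 1 (Set.Iio 1)) (nhds w) :=
    tendsto_ofReal_mul w
  have hp : 0 < ‖1 + w‖ / 4 := by have := norm_pos_iff.2 hw1; positivity
  have hfar : ∀ᶠ ρ : ℝ in nhdsWithin 1 (Set.Iio 1), ‖1 + w‖ / 2 ≤ ‖1 + (ρ : ℂ) * w‖ := by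
    have h1 := (ht.const_add 1).norm
    refine (h1.eventually (lt_mem_nhds (?_ : ‖1 + w‖ / 2 < ‖1 + w‖))).mono fun ρ h => h.le
    linarith
  have hmain := tendsto_tprod_one_add_of_dominated_convergence
    (𝓕 := nhdsWithin (1:ℝ) (Set.Iio 1))
    (f := fun (ρ : ℝ) n => (1 + (r n : ℂ)) * ((ρ : ℂ) * w - 1) / (1 - r n * ((ρ : ℂ) * w)))
    (g := fun n => (1 + (r n : ℂ)) * (w - 1) / (1 - r n * w))
    (hs.mul_right (2 / (‖1 + w‖ / 4)))
    (fun n => ((ht.sub_const 1).const_mul _).div ((ht.const_mul _).const_sub 1)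
      (one_sub_mul_ne_zero (hr n) hw.le)) (by
      filter_upwards [hfar, eventually_mem_Ico] with ρ h1 hρ n
      refine norm_blaschkeFactor_sub_one_le (hr n) (hnorm ρ hρ) hp ?_
      linarith [norm_one_add_le_two_mul (hr n) (hnorm ρ hρ)])
  simp_rw [fun n => blaschkeFactor_eq_one_add (hr n) hw.le]
  refine hmain.congr' ?_
  filter_upwards [eventually_mem_Ico] with ρ hρ
  simp_rw [fun n => blaschkeFactor_eq_one_add (hr n) (hnorm ρ hρ)]

end Blaschke

theorem HasBoundaryValues.aestronglyMeasurable {G : ℂ → ℂ} {Gs : ℝ → ℂ}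
    (hG : HasBoundaryValues G Gs) :
    AEStronglyMeasurable Gs (volume.restrict (Set.uIoc 0 (2 * Real.pi))) := by
  have h := (hG.integral_mul_eq_zero (φ := uc) (continuous_uc.intervalIntegrable _ _) fun n => by
    simpa [pow_succ'] using integral_uc_pow 0 (n + 1) n.succ_ne_zero).1
  have h' := h.aestronglyMeasurable_restrict_uIoc.mul
    (continuous_uc.inv₀ uc_ne_zero).aestronglyMeasurable
  refine h'.congr (ae_of_all _ fun θ => ?_)
  simp [uc_ne_zero]

theorem integral_mul_inv_pow_eq_zero {ψ : ℝ → ℂ}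
    (hψ : IntervalIntegrable ψ volume 0 (2 * Real.pi))
    (h0 : ∀ z ∈ unitDisk, szProj ψ z = 0) (n : ℕ) :
    ∫ θ in (0:ℝ)..(2 * Real.pi), ψ θ * (uc θ)⁻¹ ^ n = 0 := by
  set p : ℕ → ℂ := fun n => ∫ θ in (0:ℝ)..(2 * Real.pi), ψ θ * (uc θ)⁻¹ ^ n with hp
  have key : ∀ z ∈ unitDisk, HasSum (fun n => z ^ n * p n) 0 := by
    intro z hz
    have hz1 : ‖z‖ < 1 := by rwa [unitDisk, mem_ball_zero_iff] at hz
    have h1 := hasSum_integral_mul_series hψ (u := fun n t => (uc t)⁻¹ ^ n)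
      (fun n => (continuous_uc.inv₀ uc_ne_zero).pow n) (fun n t => by simp [uc_norm])
      (d := fun n => z ^ n) (by simpa using summable_geometric_of_lt_one (norm_nonneg z) hz1)
    convert h1
    have h2 := h0 z hz
    rw [szProj, mul_eq_zero] at h2
    rw [← h2.resolve_left (by simp [Real.pi_ne_zero])]
    refine intervalIntegral.integral_congr fun θ _ => ?_
    simp only [← mul_pow]
    rw [tsum_geometric_of_norm_lt_one (by simpa [uc_norm] using hz1)]
  have hmem : ∀ s, ((1 / 2 : ℝ) : ℂ) * uc s ∈ unitDisk := ofReal_mul_uc_mem ⟨by norm_num, by norm_num⟩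
  have hsum : Summable fun n => ‖((1 / 2 : ℝ) : ℂ) ^ n * p n‖ := by
    have := (key ((1 / 2 : ℝ) : ℂ) (by simpa [uc] using hmem 0)).summable.norm
    exact this
  have hP := integral_norm_sq_fourier_tsum hsum
  have hz : ∀ θ, ∑' n, ((1 / 2 : ℝ) : ℂ) ^ n * p n * uc θ ^ n = 0 := fun θ => by
    rw [← (key _ (hmem θ)).tsum_eq]
    refine tsum_congr fun n => ?_
    rw [mul_pow]; ring
  simp_rw [hz] at hP
  simp only [norm_zero, ne_eq, OfNat.ofNat_ne_zero, not_false_eq_true, zero_pow,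
    intervalIntegral.integral_zero] at hP
  have h3 := congrFun ((hasSum_zero_iff_of_nonneg fun n => by
    have := Real.pi_pos; positivity).1 hP) n
  change p n = 0
  simpa [Real.pi_ne_zero] using h3

theorem intervalIntegral_conj (F : ℝ → ℂ) (a b : ℝ) :
    ∫ t in a..b, (starRingEnd ℂ) (F t) = (starRingEnd ℂ) (∫ t in a..b, F t) := by
  simp [intervalIntegral, integral_conj]

theorem IntervalIntegrable.conj {F : ℝ → ℂ} {a b : ℝ} (hF : IntervalIntegrable F volume a b) :
    IntervalIntegrable (fun t => (starRingEnd ℂ) (F t)) volume a b := by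
  rw [intervalIntegrable_iff] at hF ⊢
  exact (Complex.conjLIE.toContinuousLinearEquiv : ℂ →L[ℝ] ℂ).integrable_comp hF

theorem modelSpace_integral_eq_zero {I h : ℂ → ℂ} {J : ℝ → ℂ} (hIJ : HasBoundaryValues I J)
    (hJ : ∀ᵐ θ : ℝ, ‖J θ‖ = 1) (hh : h ∈ modelSpace I) :
    IntervalIntegrable (fun θ => J θ * (starRingEnd ℂ) (bdry h θ)) volume 0 (2 * Real.pi) ∧
      ∀ n : ℕ, ∫ θ in (0:ℝ)..(2 * Real.pi),
        J θ * (starRingEnd ℂ) (bdry h θ) * uc θ ^ n = 0 := by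
  obtain ⟨hh2, h0⟩ := hh
  have hb := hh2.bdry_integrable_and_integral_eq_zero.1
  have hψ : IntervalIntegrable (fun θ => (starRingEnd ℂ) (J θ) * bdry h θ) volume 0
      (2 * Real.pi) := by
    refine hb.norm.mono_fun' (.mul ?_ hb.aestronglyMeasurable_restrict_uIoc) ?_
    · exact Complex.continuous_conj.comp_aestronglyMeasurable hIJ.aestronglyMeasurable
    · filter_upwards [ae_restrict_of_ae hJ] with θ hθ
      simp [hθ]
  have hI : ∀ᵐ θ : ℝ, θ ∈ Set.uIcc 0 (2 * Real.pi) → bdry I θ = J θ := by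
    filter_upwards [hIJ.2.1] with θ hθ hm
    exact (hθ hm).limUnder_eq
  have hz : ∀ z ∈ unitDisk, szProj (fun θ => (starRingEnd ℂ) (J θ) * bdry h θ) z = 0 := by
    intro z hz
    rw [← h0 z hz, toeplitz, szProj, szProj]
    congr 1
    refine intervalIntegral.integral_congr_ae ?_
    filter_upwards [hI] with θ hθ hm
    rw [conjBdry, hθ (Set.uIoc_subset_uIcc hm)]
  have hc : ∀ θ, (starRingEnd ℂ) ((starRingEnd ℂ) (J θ) * bdry h θ) =
      J θ * (starRingEnd ℂ) (bdry h θ) := fun θ => by simp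
  refine ⟨by simpa only [hc] using IntervalIntegrable.conj hψ, fun n => ?_⟩
  have h1 := congrArg (starRingEnd ℂ) (integral_mul_inv_pow_eq_zero hψ hz n)
  rw [← intervalIntegral_conj, map_zero] at h1
  rw [← h1]
  refine intervalIntegral.integral_congr fun θ _ => ?_
  simp [uc_inv]

theorem norm_mul_one_sub_div_two_le {z : ℂ} (hz : ‖z‖ ≤ 1) :
    ‖z * (1 - z) / 2‖ ≤ 1 - ‖1 + z‖ ^ 2 / 8 := by
  have h1 : ‖z * (1 - z) / 2‖ ≤ ‖1 - z‖ / 2 := by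
    rw [norm_div, norm_mul, Complex.norm_ofNat]
    gcongr
    exact mul_le_of_le_one_left (norm_nonneg _) hz
  have h2 := parallelogram_law_with_norm ℝ (1 : ℂ) z
  have h3 : ‖z‖ * ‖z‖ ≤ 1 := by nlinarith [norm_nonneg z]
  rw [norm_one] at h2
  nlinarith [sq_nonneg (‖1 - z‖ - 2)]

theorem norm_one_add_sq_le {u z : ℂ} (hu : ‖u‖ ≤ 1) (hz : ‖z‖ ≤ 1) :
    ‖1 + z‖ ^ 2 ≤ 8 * ‖1 - u * (z * (1 - z) / 2)‖ := by
  have h1 := norm_mul_one_sub_div_two_le hz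
  have h2 := norm_sub_norm_le 1 (u * (z * (1 - z) / 2))
  rw [norm_one, norm_mul u] at h2
  have h3 := mul_le_of_le_one_left (norm_nonneg (z * (1 - z) / 2)) hu
  linarith

theorem one_sub_mul_b_ne_zero {u z : ℂ} (hu : ‖u‖ ≤ 1) (hz : ‖z‖ ≤ 1) (hz1 : 1 + z ≠ 0) :
    1 - u * (z * (1 - z) / 2) ≠ 0 := by
  have h := norm_one_add_sq_le hu hz
  have := norm_pos_iff.2 hz1
  rw [← norm_pos_iff]
  nlinarith

/-- The real weight `-r|1+w|²/|1-rw|²` on the unit circle; it tends to `1` as `r → -1`. -/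
def circleWeight (r : ℝ) (w : ℂ) : ℝ := -r * ‖1 + w‖ ^ 2 / ‖1 - r * w‖ ^ 2

theorem norm_sq_add_mul_norm_sq (r : ℝ) {w : ℂ} (hw : ‖w‖ = 1) :
    ‖1 - r * w‖ ^ 2 = (1 + r) ^ 2 + -r * ‖1 + w‖ ^ 2 := by
  have h : w.re * w.re + w.im * w.im = 1 := by
    rw [← Complex.normSq_apply, Complex.normSq_eq_norm_sq, hw, one_pow]
  rw [← Complex.normSq_eq_norm_sq, ← Complex.normSq_eq_norm_sq, Complex.normSq_apply,
    Complex.normSq_apply]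
  simp
  linear_combination (r ^ 2 + r) * h

theorem abs_circleWeight_le_one {r : ℝ} (hr : r ∈ Set.Ioo (-1 : ℝ) 0) {w : ℂ} (hw : ‖w‖ = 1) :
    |circleWeight r w| ≤ 1 := by
  have h0 : 0 ≤ -r * ‖1 + w‖ ^ 2 := mul_nonneg (by linarith [hr.2]) (sq_nonneg _)
  rw [circleWeight, abs_of_nonneg (div_nonneg h0 (sq_nonneg _))]
  refine div_le_one_of_le₀ ?_ (sq_nonneg _)
  rw [norm_sq_add_mul_norm_sq r hw]
  nlinarith [sq_nonneg (1 + r)]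

theorem circleWeight_eq {r : ℝ} (hr : r ∈ Set.Ioo (-1 : ℝ) 0) {w : ℂ} (hw : ‖w‖ = 1) :
    (circleWeight r w : ℂ) = -r * (1 + w) ^ 2 / (1 - r * w) / (w - r) := by
  have hd := one_sub_mul_ne_zero hr hw.le
  have hww : w * (starRingEnd ℂ) w = 1 := by rw [Complex.mul_conj', hw]; simp
  have hw0 : w ≠ 0 := norm_ne_zero_iff.1 (by rw [hw]; exact one_ne_zero)
  have hc : w - r = w * (1 - r * (starRingEnd ℂ) w) := by linear_combination (r : ℂ) * hww
  have hd' : 1 - r * (starRingEnd ℂ) w ≠ 0 :=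
    one_sub_mul_ne_zero hr (by rw [RCLike.norm_conj]; exact hw.le)
  rw [circleWeight]
  push_cast
  rw [← Complex.mul_conj', ← Complex.mul_conj', hc]
  simp only [map_add, map_sub, map_mul, map_one, Complex.conj_ofReal]
  rw [div_div, div_eq_div_iff (mul_ne_zero hd hd') (mul_ne_zero hd (mul_ne_zero hw0 hd'))]
  linear_combination (-r * (1 + w) * (1 - r * w) * (1 - r * (starRingEnd ℂ) w)) * hww

theorem continuous_circleWeight_uc {r : ℝ} (hr : r ∈ Set.Ioo (-1 : ℝ) 0) :
    Continuous fun θ => circleWeight r (uc θ) := by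
  have h1 := continuous_uc
  unfold circleWeight
  refine Continuous.div (by fun_prop) (by fun_prop) fun θ => ?_
  exact pow_ne_zero _ (norm_ne_zero_iff.2 (one_sub_mul_ne_zero hr (uc_norm θ).le))

theorem tendsto_circleWeight {w : ℂ} (hw1 : 1 + w ≠ 0) {r : ℕ → ℝ}
    (hr : Tendsto r atTop (nhds (-1))) :
    Tendsto (fun j => circleWeight (r j) w) atTop (nhds 1) := by
  have h0 : ‖1 + w‖ ^ 2 ≠ 0 := pow_ne_zero _ (norm_ne_zero_iff.2 hw1)
  have h1 : Tendsto (fun j => ‖1 - (r j : ℂ) * w‖ ^ 2) atTop (nhds (‖1 + w‖ ^ 2)) := by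
    have := ((((Complex.continuous_ofReal.tendsto _).comp hr).mul_const w).const_sub 1).norm.pow 2
    simpa using this
  have h2 : Tendsto (fun j => circleWeight (r j) w) atTop (nhds _) :=
    (hr.neg.mul_const (‖1 + w‖ ^ 2)).div h1 h0
  simpa [div_self h0] using h2

/-- The analytic extension of `circleWeight r · b / (1 - b)` with `b = I·z(1-z)/2`, `I r = 0`. -/
def weightedQuot (I : ℂ → ℂ) (r : ℝ) (z : ℂ) : ℂ :=
  -r * (1 + z) ^ 2 / (1 - r * z) * (z * (1 - z) / 2) * dslope I r z /
    (1 - I z * (z * (1 - z) / 2))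

theorem hasBoundaryValues_weightedQuot {I : ℂ → ℂ} {J : ℝ → ℂ} {r : ℝ}
    (hr : r ∈ Set.Ioo (-1 : ℝ) 0) (hId : DifferentiableOn ℂ I unitDisk)
    (hI1 : ∀ z ∈ unitDisk, ‖I z‖ ≤ 1) (hI0 : I r = 0)
    (hJ : ∀ᵐ θ : ℝ, 1 + uc θ ≠ 0 ∧ ‖J θ‖ = 1 ∧ Tendsto (fun ρ : ℝ => I ((ρ : ℂ) * uc θ))
      (nhdsWithin 1 (Set.Iio 1)) (nhds (J θ))) :
    HasBoundaryValues (weightedQuot I r) fun θ => circleWeight r (uc θ) *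
      (J θ * (uc θ * (1 - uc θ) / 2) / (1 - J θ * (uc θ * (1 - uc θ) / 2))) := by
  have hlt : ∀ z ∈ unitDisk, ‖z‖ < 1 := fun z hz => by rwa [unitDisk, mem_ball_zero_iff] at hz
  have hrd : (r : ℂ) ∈ unitDisk := by
    rw [unitDisk, mem_ball_zero_iff, Complex.norm_real, Real.norm_of_nonpos hr.2.le]
    linarith [hr.1]
  have hds : ∀ z : ℂ, z ≠ r → dslope I r z = I z / (z - r) := fun z hz => by
    rw [dslope_of_ne _ hz, slope_def_field, hI0, sub_zero]
  refine ⟨?_, ?_, 8 / (1 + r) * (2 / (1 + r)), ?_⟩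
  · have h1 : DifferentiableOn ℂ (dslope I r) unitDisk :=
      (Complex.differentiableOn_dslope (Metric.isOpen_ball.mem_nhds hrd)).2 hId
    refine DifferentiableOn.div (DifferentiableOn.mul (DifferentiableOn.mul
      (DifferentiableOn.div (by fun_prop) (by fun_prop) fun z hz => ?_) (by fun_prop)) h1)
      ((hId.mul (by fun_prop)).const_sub 1) fun z hz => ?_
    · exact one_sub_mul_ne_zero hr (hlt z hz).le
    · exact one_sub_mul_b_ne_zero (hI1 z hz) (hlt z hz).le (one_add_ne_zero_of_norm_lt (hlt z hz))
  · filter_upwards [hJ] with θ hθ _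
    obtain ⟨h1, h2, h3⟩ := hθ
    have hw := uc_norm θ
    have hne : uc θ ≠ r := fun h => by
      have := hlt _ hrd
      rw [← h, hw] at this
      exact lt_irrefl _ this
    have ht := tendsto_ofReal_mul (uc θ)
    have hden := one_sub_mul_b_ne_zero h2.le hw.le h1
    have hl : Tendsto (fun ρ : ℝ => weightedQuot I r ((ρ : ℂ) * uc θ)) (nhdsWithin 1 (Set.Iio 1))
        (nhds (-r * (1 + uc θ) ^ 2 / (1 - r * uc θ) * (uc θ * (1 - uc θ) / 2) *
          (J θ / (uc θ - r)) / (1 - J θ * (uc θ * (1 - uc θ) / 2)))) := by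
      have hb := (ht.mul (ht.const_sub 1)).div_const 2
      refine Tendsto.div (((Tendsto.div ((((ht.const_add 1).pow 2)).const_mul _)
        ((ht.const_mul _).const_sub 1) (one_sub_mul_ne_zero hr hw.le)).mul hb).mul ?_)
        ((h3.mul hb).const_sub 1) hden
      refine (h3.div (ht.sub_const _) (sub_ne_zero.2 hne)).congr' ?_
      filter_upwards [ht.eventually_ne hne] with ρ hρ
      exact (hds _ hρ).symm
    convert hl using 2
    rw [circleWeight_eq hr hw]
    ring
  · have hev : ∀ᶠ ρ : ℝ in nhdsWithin 1 (Set.Iio 1), (1 - r) / 2 < ρ :=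
      (tendsto_id.mono_left nhdsWithin_le_nhds).eventually (lt_mem_nhds (by linarith [hr.1]))
    filter_upwards [hev, eventually_mem_Ico] with ρ hρ hρ1 θ
    have hzd := ofReal_mul_uc_mem hρ1 θ
    have hzn := norm_ofReal_mul_uc hρ1.1 θ
    set z : ℂ := (ρ : ℂ) * uc θ
    have hz1 := hlt z hzd
    have hp : 0 < 1 + r := by linarith [hr.1]
    have hnr : ‖(r : ℂ)‖ = -r := by rw [Complex.norm_real, Real.norm_of_nonpos hr.2.le]
    have hzr : (1 + r) / 2 ≤ ‖z - r‖ := by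
      have := norm_sub_norm_le z r
      rw [hzn, hnr] at this
      linarith
    have hne : z ≠ r := fun h => by
      rw [h, sub_self, norm_zero] at hzr
      linarith
    have h1r : 1 + r ≤ ‖1 - r * z‖ := by
      have := norm_sub_norm_le 1 (r * z)
      rw [norm_one, norm_mul, hnr] at this
      nlinarith [hr.2, norm_nonneg z]
    have hb := norm_mul_one_sub_div_two_le hz1.le
    have hD := norm_one_add_sq_le (hI1 z hzd) hz1.le
    have hDp := norm_pos_iff.2 (one_sub_mul_b_ne_zero (hI1 z hzd) hz1.le
      (one_add_ne_zero_of_norm_lt hz1))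
    have hsplit : weightedQuot I r z = (-r * (z * (1 - z) / 2) * I z) *
        ((1 + z) ^ 2 / (1 - I z * (z * (1 - z) / 2)) / (1 - r * z)) * (1 / (z - r)) := by
      rw [weightedQuot, hds z hne]
      ring
    rw [hsplit, norm_mul, norm_mul]
    have hA : ‖-(r : ℂ) * (z * (1 - z) / 2) * I z‖ ≤ 1 := by
      rw [norm_mul, norm_mul, norm_neg, hnr]
      have h1 : ‖z * (1 - z) / 2‖ ≤ 1 := hb.trans (by linarith [sq_nonneg ‖1 + z‖])
      exact mul_le_one₀ (mul_le_one₀ (by linarith) (norm_nonneg _) h1) (norm_nonneg _) (hI1 z hzd)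
    have hB : ‖(1 + z) ^ 2 / (1 - I z * (z * (1 - z) / 2)) / (1 - r * z)‖ ≤ 8 / (1 + r) := by
      rw [norm_div, norm_div, norm_pow]
      refine div_le_div₀ (by norm_num) ?_ hp h1r
      rwa [div_le_iff₀ hDp]
    have hC : ‖1 / (z - r)‖ ≤ 2 / (1 + r) := by
      rw [norm_div, norm_one, ← one_div_div (1 + r)]
      exact one_div_le_one_div_of_le (by linarith) hzr
    calc _ ≤ 1 * (8 / (1 + r)) * (2 / (1 + r)) := by gcongr
      _ = _ := by rw [one_mul]

theorem ae_one_add_uc_ne_zero : ∀ᵐ θ : ℝ, 1 + uc θ ≠ 0 := by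
  have hc : (Set.range fun k : ℤ => Real.pi + k * (2 * Real.pi)).Countable :=
    Set.countable_range _
  filter_upwards [hc.ae_notMem volume] with θ hθ h
  refine hθ ?_
  have h1 : Real.cos θ = -1 := by
    have h2 := congrArg Complex.re h
    rw [uc_eq_cos_sin] at h2
    simp [Complex.cos_ofReal_re, Complex.sin_ofReal_im] at h2
    linarith
  exact Real.cos_eq_neg_one_iff.1 h1

theorem tendsto_integral_weight_mul {m : ℕ → ℝ → ℝ} {X : ℝ → ℂ} {a b : ℝ}
    (hm : ∀ j, Continuous (m j)) (hm1 : ∀ j θ, |m j θ| ≤ 1)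
    (hlim : ∀ᵐ θ : ℝ, Tendsto (fun j => m j θ) atTop (nhds 1))
    (hX : IntervalIntegrable X volume a b) :
    Tendsto (fun j => ∫ θ in a..b, (m j θ : ℂ) * X θ) atTop (nhds (∫ θ in a..b, X θ)) := by
  refine intervalIntegral.tendsto_integral_filter_of_dominated_convergence (fun θ => ‖X θ‖)
    (Eventually.of_forall fun j => ?_) (Eventually.of_forall fun j => ae_of_all _ fun θ _ => ?_)
    hX.norm ?_
  · exact (Complex.continuous_ofReal.comp (hm j)).aestronglyMeasurable.mul
      hX.aestronglyMeasurable_restrict_uIoc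
  · rw [norm_mul, Complex.norm_real]
    exact mul_le_of_le_one_left (norm_nonneg _) (hm1 j θ)
  · filter_upwards [hlim] with θ hθ _
    have := ((Complex.continuous_ofReal.tendsto _).comp hθ).mul_const (X θ)
    simpa using this

theorem integral_eq_of_weight {m : ℕ → ℝ → ℝ} {X Y : ℝ → ℂ} {P : ℕ → ℝ → ℂ} {a b : ℝ}
    (hm : ∀ j, Continuous (m j)) (hm1 : ∀ j θ, |m j θ| ≤ 1)
    (hlim : ∀ᵐ θ : ℝ, Tendsto (fun j => m j θ) atTop (nhds 1))
    (hX : IntervalIntegrable X volume a b) (hY : IntervalIntegrable Y volume a b)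
    (hP : ∀ j, IntervalIntegrable (P j) volume a b ∧ ∫ θ in a..b, P j θ = 0)
    (h : ∀ j, ∀ᵐ θ : ℝ, θ ∈ Set.uIoc a b → (m j θ : ℂ) * X θ = P j θ + m j θ * Y θ) :
    ∫ θ in a..b, X θ = ∫ θ in a..b, Y θ := by
  refine tendsto_nhds_unique (tendsto_integral_weight_mul hm hm1 hlim hX)
    ((tendsto_integral_weight_mul hm hm1 hlim hY).congr fun j => ?_)
  have hmY : IntervalIntegrable (fun θ => (m j θ : ℂ) * Y θ) volume a b :=
    hY.continuousOn_mul (Complex.continuous_ofReal.comp (hm j)).continuousOn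
  rw [intervalIntegral.integral_congr_ae (h j), intervalIntegral.integral_add (hP j).1 hmY,
    (hP j).2, zero_add]

theorem pairing_identity (r : ℝ) (J w H : ℂ) (hw : ‖w‖ = 1) (hJ : ‖J‖ = 1)
    (hr : 1 - r * w ≠ 0) (hb : 1 - J * (w * (1 - w) / 2) ≠ 0) :
    ((1 + w) / 2 / (1 - J * (w * (1 - w) / 2)) * (1 - r * w)⁻¹ * J -
        r * (1 - r) / 2 * ((1 + w) / 2 / (1 - J * (w * (1 - w) / 2)) * (1 - r * w)⁻¹)) *
      (starRingEnd ℂ) ((1 + w) / 2 / (1 - J * (w * (1 - w) / 2)) * H) =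
    (J * (w * (1 - w) / 2) / (1 - J * (w * (1 - w) / 2)) + 1) *
        ((1 - r * (1 - r) / 2 * (w * (1 - w) / 2)) / (1 - r * w)) * (J * (starRingEnd ℂ) H) +
      (starRingEnd ℂ) ((J * (w * (1 - w) / 2) / (1 - J * (w * (1 - w) / 2)) + 1) *
        ((1 - w - r) / 2) * (H * w)) := by
  have hww : w * (starRingEnd ℂ) w = 1 := by rw [Complex.mul_conj', hw]; simp
  have hJJ : J * (starRingEnd ℂ) J = 1 := by rw [Complex.mul_conj', hJ]; simp
  have hb' : 1 - (starRingEnd ℂ) J * ((starRingEnd ℂ) w * (1 - (starRingEnd ℂ) w) / 2) ≠ 0 := by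
    have := (map_ne_zero (starRingEnd ℂ)).2 hb
    simpa [map_ofNat] using this
  simp only [map_mul, map_add, map_sub, map_div₀, map_one, map_ofNat, Complex.conj_ofReal]
  generalize (starRingEnd ℂ) w = v at *
  generalize (starRingEnd ℂ) J = K at *
  generalize (starRingEnd ℂ) H = G at *
  have e1 : J * (w * (1 - w) / 2) / (1 - J * (w * (1 - w) / 2)) + 1 =
      1 / (1 - J * (w * (1 - w) / 2)) := by rw [div_add_one hb]; congr 1; ring
  have e2 : K * (v * (1 - v) / 2) / (1 - K * (v * (1 - v) / 2)) + 1 =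
      1 / (1 - K * (v * (1 - v) / 2)) := by rw [div_add_one hb']; congr 1; ring
  rw [e1, e2]
  have e3 : (1 - v - r) / 2 * v = (v * (1 - v) / 2 - r * (1 - r) / 2) / (1 - r * w) := by
    rw [eq_div_iff hr]
    linear_combination (-(1 - v - r) * r / 2) * hww
  have e4 : (1 + w) * (1 + v) / 4 = 1 - w * (1 - w) / 2 * (v * (1 - v) / 2) := by
    linear_combination (1 / 2 + (1 - w - v + w * v) / 4) * hww
  have e5 : ∀ D E S : ℂ, D ≠ 0 → E ≠ 0 → S ≠ 0 →
      D = 1 - J * (w * (1 - w) / 2) → E = 1 - K * (v * (1 - v) / 2) →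
      ((1 + w) / 2 / D * S⁻¹ * J - r * (1 - r) / 2 * ((1 + w) / 2 / D * S⁻¹)) *
        ((1 + v) / 2 / E * G) =
      1 / D * ((1 - r * (1 - r) / 2 * (w * (1 - w) / 2)) / S) * (J * G) +
        1 / E * ((v * (1 - v) / 2 - r * (1 - r) / 2) / S) * G := by
    intro D E S hD hE hS eD eE
    have : (1 + w) / 2 * (J - r * (1 - r) / 2) * ((1 + v) / 2) =
        E * (1 - r * (1 - r) / 2 * (w * (1 - w) / 2)) * J +
          D * (v * (1 - v) / 2 - r * (1 - r) / 2) := by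
      rw [eD, eE]
      linear_combination (J - r * (1 - r) / 2) * e4 +
        (v * (1 - v) / 2 * (1 - r * (1 - r) / 2 * (w * (1 - w) / 2))) * hJJ
    field_simp
    field_simp at this
    linear_combination G * this
  rw [e5 _ _ _ hb hb' hr rfl rfl, ← e3]
  ring

theorem integral_pairing_eq_zero {I h : ℂ → ℂ} {J : ℝ → ℂ} {r : ℕ → ℝ}
    (hr : ∀ n, r n ∈ Set.Ioo (-1 : ℝ) 0) (hrlim : Tendsto r atTop (nhds (-1)))
    (hId : DifferentiableOn ℂ I unitDisk) (hI1 : ∀ z ∈ unitDisk, ‖I z‖ ≤ 1)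
    (hI0 : ∀ n, I (r n) = 0)
    (hJ : ∀ᵐ θ : ℝ, 1 + uc θ ≠ 0 ∧ ‖J θ‖ = 1 ∧ Tendsto (fun ρ : ℝ => I ((ρ : ℂ) * uc θ))
      (nhdsWithin 1 (Set.Iio 1)) (nhds (J θ)))
    (hh : h ∈ modelSpace I) (n : ℕ) {X : ℝ → ℂ}
    (hX : ∀ᵐ θ : ℝ, θ ∈ Set.uIoc 0 (2 * Real.pi) → X θ =
      (J θ * (uc θ * (1 - uc θ) / 2) / (1 - J θ * (uc θ * (1 - uc θ) / 2)) + 1) *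
        ((1 - r n * (1 - r n) / 2 * (uc θ * (1 - uc θ) / 2)) / (1 - r n * uc θ)) *
          (J θ * (starRingEnd ℂ) (bdry h θ)) +
      (starRingEnd ℂ) ((J θ * (uc θ * (1 - uc θ) / 2) / (1 - J θ * (uc θ * (1 - uc θ) / 2)) + 1) *
        ((1 - uc θ - r n) / 2) * (bdry h θ * uc θ))) :
    ∫ θ in (0:ℝ)..(2 * Real.pi), X θ = 0 := by
  by_cases hXi : IntervalIntegrable X volume 0 (2 * Real.pi)
  swap
  · exact intervalIntegral.integral_undef hXi
  have hIJ : HasBoundaryValues I J := ⟨hId, hJ.mono fun θ hθ _ => hθ.2.2, 1, by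
    filter_upwards [eventually_mem_Ico] with ρ hρ θ using hI1 _ (ofReal_mul_uc_mem hρ θ)⟩
  obtain ⟨hφ, hφ0⟩ := modelSpace_integral_eq_zero hIJ (hJ.mono fun θ hθ => hθ.2.1) hh
  obtain ⟨hb, hb0⟩ := hh.1.bdry_integrable_and_integral_eq_zero
  have hφ' : IntervalIntegrable (fun θ => bdry h θ * uc θ) volume 0 (2 * Real.pi) :=
    hb.mul_continuousOn continuous_uc.continuousOn
  have hφ'0 : ∀ k : ℕ, ∫ θ in (0:ℝ)..(2 * Real.pi), bdry h θ * uc θ * uc θ ^ k = 0 := fun k => by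
    rw [← hb0 k]
    exact intervalIntegral.integral_congr fun θ _ => by ring
  have hV1 : HasBoundaryValues _ fun θ : ℝ =>
      (1 - r n * (1 - r n) / 2 * (uc θ * (1 - uc θ) / 2)) / (1 - r n * uc θ) :=
    hasBoundaryValues_of_differentiableAt
      (V := fun z => (1 - r n * (1 - r n) / 2 * (z * (1 - z) / 2)) / (1 - r n * z)) fun z hz =>
      DifferentiableAt.div (by fun_prop) (by fun_prop) (one_sub_mul_ne_zero (hr n) hz)
  have hV2 : HasBoundaryValues _ fun θ : ℝ => (1 - uc θ - r n) / 2 :=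
    hasBoundaryValues_of_differentiableAt (V := fun z => (1 - z - r n) / 2) fun z hz => by fun_prop
  have hsum : ∀ {F G : ℝ → ℂ},
      IntervalIntegrable F volume 0 (2 * Real.pi) ∧ ∫ θ in (0:ℝ)..(2 * Real.pi), F θ = 0 →
      IntervalIntegrable G volume 0 (2 * Real.pi) ∧ ∫ θ in (0:ℝ)..(2 * Real.pi), G θ = 0 →
      IntervalIntegrable (fun θ => F θ + (starRingEnd ℂ) (G θ)) volume 0 (2 * Real.pi) ∧
        ∫ θ in (0:ℝ)..(2 * Real.pi), (F θ + (starRingEnd ℂ) (G θ)) = 0 := by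
    intro F G hF hG
    refine ⟨hF.1.add hG.1.conj, ?_⟩
    rw [intervalIntegral.integral_add hF.1 hG.1.conj, hF.2, intervalIntegral_conj, hG.2, map_zero,
      add_zero]
  have hY := hsum (hV1.integral_mul_eq_zero hφ hφ0) (hV2.integral_mul_eq_zero hφ' hφ'0)
  have hU := fun j => hasBoundaryValues_weightedQuot (hr j) hId hI1 (hI0 j) hJ
  have hP := fun j => hsum (((hU j).mul hV1).integral_mul_eq_zero hφ hφ0)
    (((hU j).mul hV2).integral_mul_eq_zero hφ' hφ'0)
  rw [← hY.2]
  refine integral_eq_of_weight (m := fun j θ => circleWeight (r j) (uc θ))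
    (fun j => continuous_circleWeight_uc (hr j))
    (fun j θ => abs_circleWeight_le_one (hr j) (uc_norm θ)) ?_ hXi hY.1 hP fun j => ?_
  · filter_upwards [hJ] with θ hθ using tendsto_circleWeight hθ.1 hrlim
  · filter_upwards [hX] with θ hθ hm
    rw [hθ hm]
    simp only [map_mul, map_add, map_one, Complex.conj_ofReal]
    ring

theorem tendsto_f_radial {I : ℂ → ℂ} {w j : ℂ} (hw : ‖w‖ = 1) (hw1 : 1 + w ≠ 0) (hj : ‖j‖ = 1)
    (hI : Tendsto (fun ρ : ℝ => I ((ρ : ℂ) * w)) (nhdsWithin 1 (Set.Iio 1)) (nhds j)) :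
    Tendsto (fun ρ : ℝ => (1 + (ρ : ℂ) * w) / 2 /
      (1 - I ((ρ : ℂ) * w) * ((ρ : ℂ) * w * (1 - (ρ : ℂ) * w) / 2))) (nhdsWithin 1 (Set.Iio 1))
      (nhds ((1 + w) / 2 / (1 - j * (w * (1 - w) / 2)))) := by
  have ht := tendsto_ofReal_mul w
  exact ((ht.const_add 1).div_const 2).div
    ((hI.mul ((ht.mul (ht.const_sub 1)).div_const 2)).const_sub 1)
    (one_sub_mul_b_ne_zero hj.le hw.le hw1)

/-- Remark, second computation.  In the setting of the Example,
for every `n` the function `f·k_{rₙ}·I − b₀(rₙ)·f·k_{rₙ}` is orthogonal in `H²`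
to the subspace `f·K_I`. -/
theorem orthogonal_to_fKI (r : ℕ → ℝ)
    (hr : ∀ n, r n ∈ Set.Ioo (-1 : ℝ) 0)
    (hrlim : Filter.Tendsto r Filter.atTop (nhds (-1)))
    (hblaschke : Summable fun n => 1 + r n)
    (B a b₀ I f : ℂ → ℂ)
    (hB : ∀ z ∈ unitDisk, B z = ∏' n, ((z - (r n : ℂ)) / (1 - (r n : ℂ) * z)))
    (ha : ∀ z, a z = (1 + z) / 2)
    (hb₀ : ∀ z, b₀ z = z * (1 - z) / 2)
    (hI : ∀ z, I z = z * B z)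
    (hf : ∀ z, f z = a z / (1 - I z * b₀ z)) :
    ∀ (n : ℕ), ∀ g ∈ fModel f I,
      bInner (fun z =>
          f z * szKernel ((r n : ℝ) : ℂ) z * I z
            - b₀ ((r n : ℝ) : ℂ) * (f z * szKernel ((r n : ℝ) : ℂ) z)) g = 0 := by
  intro n g hg
  obtain ⟨h, hh, hgh⟩ := hg
  have hlt : ∀ z ∈ unitDisk, ‖z‖ < 1 := fun z hz => by rwa [unitDisk, mem_ball_zero_iff] at hz
  have hIB : ∀ z ∈ unitDisk, I z = z * ∏' k, blaschkeFactor (r k) z := fun z hz => by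
    rw [hI, hB z hz]; rfl
  have hId : DifferentiableOn ℂ I unitDisk :=
    (differentiableOn_id.mul (differentiableOn_tprod_blaschkeFactor hr hblaschke)).congr hIB
  have hI1 : ∀ z ∈ unitDisk, ‖I z‖ ≤ 1 := fun z hz => by
    rw [hIB z hz, norm_mul]
    exact mul_le_one₀ (hlt z hz).le (norm_nonneg _)
      (norm_tprod_blaschkeFactor_le_one hr hblaschke (hlt z hz))
  have hI0 : ∀ k, I (r k) = 0 := fun k => by
    rw [hIB, tprod_of_exists_eq_zero ⟨k, by simp [blaschkeFactor]⟩, mul_zero]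
    rw [unitDisk, mem_ball_zero_iff, Complex.norm_real, Real.norm_of_nonpos (hr k).2.le]
    linarith [(hr k).1]
  have hJ : ∀ᵐ θ : ℝ, 1 + uc θ ≠ 0 ∧ ‖uc θ * ∏' k, blaschkeFactor (r k) (uc θ)‖ = 1 ∧
      Tendsto (fun ρ : ℝ => I ((ρ : ℂ) * uc θ)) (nhdsWithin 1 (Set.Iio 1))
        (nhds (uc θ * ∏' k, blaschkeFactor (r k) (uc θ))) := by
    filter_upwards [ae_one_add_uc_ne_zero] with θ hθ
    refine ⟨hθ, ?_, ?_⟩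
    · rw [norm_mul, uc_norm, norm_tprod_blaschkeFactor_eq_one hr hblaschke (uc_norm θ) hθ, one_mul]
    · refine ((tendsto_ofReal_mul (uc θ)).mul
        (tendsto_tprod_blaschkeFactor hr hblaschke (uc_norm θ) hθ)).congr' ?_
      filter_upwards [eventually_mem_Ico] with ρ hρ
      rw [hIB _ (ofReal_mul_uc_mem hρ θ)]
  rw [bInner, integral_pairing_eq_zero hr hrlim hId hI1 hI0 hJ hh n, mul_zero]
  filter_upwards [hJ, hh.1.ae_tendsto_bdry] with θ hθ hhθ hm
  obtain ⟨hw1, hJ1, hIlim⟩ := hθ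
  have hfl := tendsto_f_radial (uc_norm θ) hw1 hJ1 hIlim
  have hrn := one_sub_mul_ne_zero (hr n) (uc_norm θ).le
  have hk := (((tendsto_ofReal_mul (uc θ)).const_mul (r n : ℂ)).const_sub 1).inv₀ hrn
  have hF := ((hfl.mul hk).mul hIlim).sub
    ((hfl.mul hk).const_mul ((r n : ℂ) * (1 - (r n : ℂ)) / 2))
  have hG := hfl.mul (hhθ (Set.uIoc_subset_uIcc hm))
  have hg' : bdry g θ = _ := (hG.congr' (by
    filter_upwards [eventually_mem_Ico] with ρ hρ
    rw [hgh _ (ofReal_mul_uc_mem hρ θ), hf, ha, hb₀])).limUnder_eq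
  simp only [hf, ha, hb₀, szKernel, Complex.conj_ofReal]
  rw [hg']
  exact (congrArg (· * _) hF.limUnder_eq).trans (pairing_identity (r n) _ _ _ (uc_norm θ) hJ1 hrn
    (one_sub_mul_b_ne_zero hJ1.le (uc_norm θ).le hw1))

end
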